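/- Let C : F(X,Y,Z) = 0 be a smooth projective plane curve of degree d ≥ 5 over a number field k. Then every quadratic geometric progression sequence on C is of finite length. -/

import Mathlib

open MvPolynomial

set_option synthInstance.maxHeartbeats 400000
set_option maxHeartbeats 1000000

noncomputable section

/-- `F` defines a smooth projective plane curve of degree `d` over `k`: it is homogeneous of
degree `d` and, over the algebraic closure of `k`, `F` and its partial derivatives have no
common nontrivial zero (the Jacobian criterion for smoothness of the plane curve `F = 0`). -/
def IsSmoothPlaneCurve {k : Type} [Field k] (d : ℕ) (F : MvPolynomial (Fin 3) k) : Prop :=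
  F.IsHomogeneous d ∧
    ∀ P : Fin 3 → AlgebraicClosure k, P ≠ 0 →
      ∃ i : Fin 3, eval P (map (algebraMap k (AlgebraicClosure k)) (pderiv i F)) ≠ 0

theorem exists_monic_mul_eq_of_isAdicComplete {A : Type*} [CommRing A] [IsDomain A] [IsLocalRing A]
    [IsAdicComplete (IsLocalRing.maximalIdeal A) A] (g : Polynomial A) (hg : g.Monic) (m : ℕ)
    (hlt : ∀ j < m, g.coeff j ∈ IsLocalRing.maximalIdeal A)
    (hm : g.coeff m ∉ IsLocalRing.maximalIdeal A) :
    ∃ P Q : Polynomial A, P.Monic ∧ Q.Monic ∧ g = P * Q ∧ P.natDegree = m := by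
  have hc (j : ℕ) : PowerSeries.coeff j ((g : PowerSeries A).map (IsLocalRing.residue A)) =
      IsLocalRing.residue A (g.coeff j) := by simp
  have hm' : IsLocalRing.residue A (g.coeff m) ≠ 0 := by
    rwa [Ne, IsLocalRing.residue_eq_zero_iff]
  have hord : ((g : PowerSeries A).map (IsLocalRing.residue A)).order = m := by
    rw [PowerSeries.order_eq_nat]
    refine ⟨by rwa [hc], fun i hi => ?_⟩
    rw [hc, IsLocalRing.residue_eq_zero_iff]
    exact hlt i hi
  have hne : (g : PowerSeries A).map (IsLocalRing.residue A) ≠ 0 := by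
    intro h
    apply hm'
    rw [← hc, h, map_zero]
  obtain ⟨P, h, H⟩ := PowerSeries.exists_isWeierstrassFactorization hne
  have hPm : P.natDegree = m := by
    rw [H.natDegree_eq_toNat_order_map, hord]; simp
  have hdvd : P ∣ g := by
    rw [← Ideal.mem_span_singleton, ← Ideal.Quotient.eq_zero_iff_mem]
    apply H.isDistinguishedAt.algEquivQuotient.injective
    rw [map_zero, Polynomial.IsDistinguishedAt.algEquivQuotient_apply]
    refine (Ideal.Quotient.eq_zero_iff_mem (I := Ideal.span {(P : PowerSeries A)})).2 ?_
    exact Ideal.mem_span_singleton.2 ⟨h, H.eq_mul⟩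
  obtain ⟨Q, hQ⟩ := hdvd
  exact ⟨P, Q, H.isDistinguishedAt.monic,
    H.isDistinguishedAt.monic.of_mul_monic_left (hQ ▸ hg), hQ, hPm⟩


theorem PowerSeries.exists_monic_mul_eq {K : Type*} [Field K]
    (g : Polynomial (PowerSeries K)) (hg : g.Monic) (m : ℕ)
    (hlt : ∀ j < m, PowerSeries.constantCoeff (g.coeff j) = 0)
    (hm : PowerSeries.constantCoeff (g.coeff m) ≠ 0) :
    ∃ P Q : Polynomial (PowerSeries K), P.Monic ∧ Q.Monic ∧ g = P * Q ∧ P.natDegree = m := by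
  have : IsAdicComplete (IsLocalRing.maximalIdeal (PowerSeries K)) (PowerSeries K) := by
    rw [PowerSeries.maximalIdeal_eq_span_X]; infer_instance
  apply exists_monic_mul_eq_of_isAdicComplete g hg m
  · intro j hj
    rw [PowerSeries.maximalIdeal_eq_span_X, Ideal.mem_span_singleton, PowerSeries.X_dvd_iff]
    exact hlt j hj
  · rwa [PowerSeries.maximalIdeal_eq_span_X, Ideal.mem_span_singleton, PowerSeries.X_dvd_iff]

/-- The ring endomorphism `u ↦ u ^ e` of the ring of formal power series in `u`. -/
def PowerSeries.expandHom (K : Type*) [Field K] (e : ℕ) (he : e ≠ 0) :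
    PowerSeries K →+* PowerSeries K :=
  (PowerSeries.expand (R := K) e he).toRingHom

theorem PowerSeries.expandHom_apply {K : Type*} [Field K] (e : ℕ) (he : e ≠ 0)
    (f : PowerSeries K) : PowerSeries.expandHom K e he f = PowerSeries.expand e he f := rfl

theorem exists_scaleRoots_of_coeff_eq_zero {K : Type*} [Field K]
    (f : Polynomial (PowerSeries K)) (hf : f.Monic) (h1 : f.coeff (f.natDegree - 1) = 0)
    (hX : f ≠ Polynomial.X ^ f.natDegree) :
    ∃ (q : ℕ) (hq : q ≠ 0) (m : ℕ) (g : Polynomial (PowerSeries K)), g.Monic ∧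
      g.natDegree = f.natDegree ∧ g.coeff (f.natDegree - 1) = 0 ∧
      f.map (PowerSeries.expandHom K q hq) =
        g.scaleRoots (PowerSeries.X ^ m) ∧
      ∃ j < f.natDegree, PowerSeries.constantCoeff (g.coeff j) ≠ 0 := by
  classical
  set r := f.natDegree with hr
  let S := (Finset.range r).filter (fun j => f.coeff j ≠ 0)
  have hS : S.Nonempty := by
    by_contra hS
    rw [Finset.not_nonempty_iff_eq_empty, Finset.filter_eq_empty_iff] at hS
    apply hX
    ext1 j
    rw [Polynomial.coeff_X_pow]
    rcases lt_trichotomy j r with h | h | h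
    · rw [if_neg h.ne]
      simpa using hS (Finset.mem_range.2 h)
    · rw [if_pos h, h]; exact hf
    · rw [if_neg h.ne']
      exact Polynomial.coeff_eq_zero_of_natDegree_lt h
  obtain ⟨j0, hj0, hmin⟩ := Finset.exists_min_image S
    (fun j => ((f.coeff j).order.toNat : ℚ) / (r - j : ℕ)) hS
  obtain ⟨hj0r, hj0n⟩ := Finset.mem_filter.1 hj0
  rw [Finset.mem_range] at hj0r
  have hq : r - j0 ≠ 0 := by omega
  set q := r - j0 with hqdef
  set m := (f.coeff j0).order.toNat with hmdef
  have hb : ∀ j, ∃ b : PowerSeries K, j ≤ r →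
      PowerSeries.expand q hq (f.coeff j) = b * (PowerSeries.X ^ m) ^ (r - j) := by
    intro j
    by_cases hjr : j ≤ r
    swap
    · exact ⟨0, fun h => absurd h hjr⟩
    rcases hjr.eq_or_lt with hjr' | hlt
    · rw [hjr']
      exact ⟨PowerSeries.expand q hq (f.coeff r), fun _ => by simp⟩
    suffices h : (PowerSeries.X ^ m) ^ (r - j) ∣ PowerSeries.expand q hq (f.coeff j) by
      obtain ⟨b, hb⟩ := h
      exact ⟨b, fun _ => by rw [hb, mul_comm]⟩
    rw [← pow_mul, PowerSeries.X_pow_dvd_iff]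
    intro n hn
    rw [PowerSeries.coeff_expand]
    split_ifs with hdvd
    swap
    · rfl
    obtain ⟨c, rfl⟩ := hdvd
    rw [Nat.mul_div_cancel_left c (Nat.pos_of_ne_zero hq)]
    by_cases h0 : f.coeff j = 0
    · rw [h0, map_zero]
    have hle := hmin j (Finset.mem_filter.2 ⟨Finset.mem_range.2 hlt, h0⟩)
    have hrj : 0 < r - j := by omega
    rw [div_le_div_iff₀ (by positivity) (by positivity)] at hle
    have hle' : m * (r - j) ≤ (f.coeff j).order.toNat * q := by exact_mod_cast hle
    apply PowerSeries.coeff_of_lt_order_toNat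
    by_contra hcon
    push Not at hcon
    have := Nat.mul_le_mul_right q hcon
    rw [mul_comm c q] at this
    omega
  choose b hb using hb
  let g : Polynomial (PowerSeries K) := ∑ j ∈ Finset.range (r + 1), Polynomial.monomial j (b j)
  have hgc (j : ℕ) : g.coeff j = if j ≤ r then b j else 0 := by
    simp [g, Polynomial.coeff_monomial]
  have hbr : b r = 1 := by
    have := hb r le_rfl
    rw [hr, hf.coeff_natDegree] at this
    simpa using this.symm
  have hgr : g.coeff r = 1 := by rw [hgc, if_pos le_rfl, hbr]
  have hgle : g.natDegree ≤ r := by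
    rw [Polynomial.natDegree_le_iff_coeff_eq_zero]
    intro j hj
    rw [hgc, if_neg (by omega)]
  have hgd : g.natDegree = r :=
    le_antisymm hgle (Polynomial.le_natDegree_of_ne_zero (by rw [hgr]; exact one_ne_zero))
  refine ⟨q, hq, m, g, ?_, hgd, ?_, ?_, j0, hj0r, ?_⟩
  · rw [Polynomial.Monic, Polynomial.leadingCoeff, hgd, hgr]
  · rw [hgc, if_pos (Nat.sub_le _ _)]
    have := hb (r - 1) (Nat.sub_le _ _)
    rw [h1, map_zero] at this
    have h2 := this.symm
    rw [mul_eq_zero] at h2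
    rcases h2 with h2 | h2
    · exact h2
    · exact absurd h2 (pow_ne_zero _ (pow_ne_zero _ PowerSeries.X_ne_zero))
  · ext1 j
    rw [Polynomial.coeff_map, Polynomial.coeff_scaleRoots, hgd, hgc, PowerSeries.expandHom_apply]
    split_ifs with h
    · exact hb j h
    · rw [Polynomial.coeff_eq_zero_of_natDegree_lt (by omega)]; simp
  · rw [hgc, if_pos hj0r.le]
    have := congrArg (PowerSeries.coeff (q * m)) (hb j0 hj0r.le)
    rw [PowerSeries.coeff_expand_mul, ← pow_mul, mul_comm q m] at this
    have h3 : PowerSeries.coeff (m * q) (b j0 * PowerSeries.X ^ (m * q)) =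
        PowerSeries.constantCoeff (b j0) := by
      have := PowerSeries.coeff_mul_X_pow (b j0) (m * q) 0
      simpa using this
    rw [h3] at this
    rw [← this]
    exact PowerSeries.coeff_order (by simpa using hj0n)

theorem Polynomial.exists_taylor_coeff_eq_zero {A : Type*} [CommRing A] [Algebra ℚ A]
    (f : Polynomial A) (hf : f.Monic) (h0 : f.natDegree ≠ 0) :
    ∃ c : A, (Polynomial.taylor c f).coeff (f.natDegree - 1) = 0 := by
  obtain ⟨r, hr⟩ := Nat.exists_eq_succ_of_ne_zero h0
  refine ⟨-(algebraMap ℚ A (1 / f.natDegree) * f.coeff (f.natDegree - 1)), ?_⟩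
  rw [Polynomial.taylor_coeff]
  have hd : (Polynomial.hasseDeriv (f.natDegree - 1) f).natDegree < 2 := by
    have := Polynomial.natDegree_hasseDeriv_le f (f.natDegree - 1)
    omega
  rw [Polynomial.eval_eq_sum_range' hd]
  simp only [Finset.sum_range_succ, Finset.sum_range_zero, Polynomial.hasseDeriv_coeff]
  have h1 : f.coeff (1 + (f.natDegree - 1)) = 1 := by
    rw [show 1 + (f.natDegree - 1) = f.natDegree by omega]; exact hf
  have h2 : ((1 + (f.natDegree - 1)).choose (f.natDegree - 1) : A) =
      algebraMap ℚ A f.natDegree := by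
    rw [show 1 + (f.natDegree - 1) = f.natDegree by omega, hr]
    simp
  rw [h1, h2]
  have h3 : algebraMap ℚ A f.natDegree * algebraMap ℚ A (1 / f.natDegree) = 1 := by
    rw [← map_mul, mul_one_div_cancel (by exact_mod_cast h0), map_one]
  simp only [zero_add, Nat.choose_self, pow_zero, pow_one, Nat.cast_one, mul_one, one_mul]
  linear_combination (-f.coeff (f.natDegree - 1)) * h3

theorem exists_rootMultiplicity_lt {K : Type*} [Field K] [CharZero K] [IsAlgClosed K]
    (g : Polynomial K) (hg : g.Monic) (h1 : g.coeff (g.natDegree - 1) = 0)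
    (hX : ∃ j < g.natDegree, g.coeff j ≠ 0) :
    ∃ α m, 0 < m ∧ m < g.natDegree ∧ (∀ j < m, (Polynomial.taylor α g).coeff j = 0) ∧
      (Polynomial.taylor α g).coeff m ≠ 0 := by
  obtain ⟨j, hj, hjn⟩ := hX
  have hpos : g.natDegree ≠ 0 := by omega
  obtain ⟨α, hα⟩ := IsAlgClosed.exists_root g (by
    rw [Polynomial.degree_eq_natDegree hg.ne_zero]; exact_mod_cast hpos)
  obtain ⟨s, hs, hsn⟩ := Polynomial.exists_eq_pow_rootMultiplicity_mul_and_not_dvd g hg.ne_zero α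
  have hm0 : 0 < g.rootMultiplicity α := (Polynomial.rootMultiplicity_pos hg.ne_zero).2 hα
  generalize g.rootMultiplicity α = m at hs hm0
  have ht : Polynomial.taylor α g = Polynomial.X ^ m * Polynomial.taylor α s := by
    conv_lhs => rw [hs]
    rw [Polynomial.taylor_mul, Polynomial.taylor_pow]
    simp
  have hsm : s.Monic := ((Polynomial.monic_X_sub_C α).pow m).of_mul_monic_left (hs ▸ hg)
  have hdeg : g.natDegree = m + s.natDegree := by
    conv_lhs => rw [hs]
    rw [((Polynomial.monic_X_sub_C α).pow m).natDegree_mul hsm]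
    simp
  refine ⟨α, m, hm0, ?_, ?_, ?_⟩
  · by_contra hlt
    have hs0 : s.natDegree = 0 := by omega
    have hs1 : s = 1 := hsm.natDegree_eq_zero.1 hs0
    rw [hs1, mul_one] at hs
    have hα0 : α = 0 := by
      rw [hs, Polynomial.natDegree_pow, Polynomial.natDegree_X_sub_C, mul_one,
        sub_eq_add_neg, ← map_neg, Polynomial.coeff_X_add_C_pow] at h1
      rw [show m - (m - 1) = 1 by omega, pow_one, mul_eq_zero] at h1
      rcases h1 with h1 | h1
      · simpa using h1
      · exfalso
        rw [Nat.cast_eq_zero, Nat.choose_eq_zero_iff] at h1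
        omega
    apply hjn
    rw [hs, hα0]
    rw [hs0] at hdeg
    simp only [map_zero, sub_zero, Polynomial.coeff_X_pow]
    rw [if_neg (by omega)]
  · intro j hj
    rw [ht, Polynomial.coeff_X_pow_mul', if_neg (by omega)]
  · rw [ht, Polynomial.coeff_X_pow_mul', if_pos le_rfl, Nat.sub_self, Polynomial.taylor_coeff_zero]
    rwa [Ne, ← Polynomial.IsRoot.def, ← Polynomial.dvd_iff_isRoot]

/-- **Newton–Puiseux**: over an algebraically closed field of characteristic zero, every monic
polynomial over `K⟦u⟧` splits after a substitution `u ↦ u ^ e`. -/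
theorem PowerSeries.exists_expandHom_splits {K : Type*} [Field K] [CharZero K] [IsAlgClosed K]
    (f : Polynomial (PowerSeries K)) (hf : f.Monic) :
    ∃ (e : ℕ) (he : e ≠ 0), (f.map (PowerSeries.expandHom K e he)).Splits := by
  induction hn : f.natDegree using Nat.strong_induction_on generalizing f with
  | _ n ih =>
  by_cases hn1 : n ≤ 1
  · refine ⟨1, one_ne_zero, ?_⟩
    apply Polynomial.Splits.of_natDegree_le_one_of_monic
    · exact Polynomial.natDegree_map_le.trans (by omega)
    · exact hf.map _
  obtain ⟨c, hc⟩ := Polynomial.exists_taylor_coeff_eq_zero f hf (by omega)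
  set f1 := Polynomial.taylor c f with hf1
  have hf1d : f1.natDegree = n := by rw [hf1, Polynomial.natDegree_taylor, hn]
  have hf1m : f1.Monic := by
    rw [Polynomial.Monic, hf1, Polynomial.leadingCoeff_taylor]; exact hf
  suffices h : ∃ (e : ℕ) (he : e ≠ 0), (f1.map (PowerSeries.expandHom K e he)).Splits by
    obtain ⟨e, he, h⟩ := h
    refine ⟨e, he, ?_⟩
    have h2 : f = Polynomial.taylor (-c) f1 := by
      rw [hf1, Polynomial.taylor_taylor]; simp
    rw [h2, Polynomial.map_taylor]
    exact h.taylor _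
  rw [hn, ← hf1d] at hc
  by_cases hX : f1 = Polynomial.X ^ f1.natDegree
  · refine ⟨1, one_ne_zero, ?_⟩
    rw [hX]
    simp
  obtain ⟨q, hq, m, g, hgm, hgd, hg1, hmap, j, hj, hjn⟩ :=
    exists_scaleRoots_of_coeff_eq_zero f1 hf1m hc hX
  suffices h : ∃ (e : ℕ) (he : e ≠ 0), (g.map (PowerSeries.expandHom K e he)).Splits by
    obtain ⟨e, he, h⟩ := h
    refine ⟨e * q, mul_ne_zero he hq, ?_⟩
    have h2 : PowerSeries.expandHom K (e * q) (mul_ne_zero he hq) =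
        (PowerSeries.expandHom K e he).comp (PowerSeries.expandHom K q hq) := by
      ext1 φ
      exact PowerSeries.expand_mul e he q hq φ
    rw [h2, ← Polynomial.map_map, hmap, Polynomial.map_scaleRoots _ _ _ (by
      rw [hgm.leadingCoeff, map_one]; exact one_ne_zero)]
    exact h.scaleRoots _
  have hgbd : (g.map (PowerSeries.constantCoeff (R := K))).natDegree = n := by
    rw [hgm.natDegree_map, hgd, hf1d]
  obtain ⟨α, m', hm0, hmlt, hlow, hne⟩ := exists_rootMultiplicity_lt
    (g.map (PowerSeries.constantCoeff (R := K))) (hgm.map _)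
    (by rw [hgbd, Polynomial.coeff_map, ← hf1d, hg1, map_zero])
    ⟨j, by rw [hgbd, ← hf1d]; exact hj, by rw [Polynomial.coeff_map]; exact hjn⟩
  rw [hgbd] at hmlt
  have hsh : Polynomial.taylor α (g.map (PowerSeries.constantCoeff (R := K))) =
      (Polynomial.taylor (PowerSeries.C α) g).map (PowerSeries.constantCoeff (R := K)) := by
    rw [Polynomial.map_taylor]; simp
  rw [hsh] at hlow hne
  have hg2m : (Polynomial.taylor (PowerSeries.C α) g).Monic := by
    rw [Polynomial.Monic, Polynomial.leadingCoeff_taylor]; exact hgm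
  obtain ⟨P, Q, hP, hQ, hPQ, hPd⟩ := PowerSeries.exists_monic_mul_eq
    (Polynomial.taylor (PowerSeries.C α) g) hg2m m'
    (fun j hj => by rw [← Polynomial.coeff_map]; exact hlow j hj)
    (by rw [← Polynomial.coeff_map]; exact hne)
  have hdeg : n = P.natDegree + Q.natDegree := by
    rw [← hP.natDegree_mul hQ, ← hPQ, Polynomial.natDegree_taylor, hgd, hf1d]
  obtain ⟨e1, he1, h1⟩ := ih P.natDegree (by omega) P hP rfl
  obtain ⟨e2, he2, h2⟩ := ih Q.natDegree (by omega) Q hQ rfl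
  refine ⟨e1 * e2, mul_ne_zero he1 he2, ?_⟩
  have h12 : PowerSeries.expandHom K (e1 * e2) (mul_ne_zero he1 he2) =
      (PowerSeries.expandHom K e1 he1).comp (PowerSeries.expandHom K e2 he2) := by
    ext1 φ
    exact PowerSeries.expand_mul e1 he1 e2 he2 φ
  have h21 : PowerSeries.expandHom K (e1 * e2) (mul_ne_zero he1 he2) =
      (PowerSeries.expandHom K e2 he2).comp (PowerSeries.expandHom K e1 he1) := by
    ext1 φ
    simp only [PowerSeries.expandHom_apply, RingHom.comp_apply]
    rw [← PowerSeries.expand_mul e2 he2 e1 he1]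
    congr 1
    simp only [mul_comm e1 e2]
  have h3 : g = Polynomial.taylor (-PowerSeries.C α) (P * Q) := by
    rw [← hPQ, Polynomial.taylor_taylor]; simp
  rw [h3, Polynomial.map_taylor, Polynomial.map_mul]
  refine (Polynomial.Splits.mul ?_ ?_).taylor _
  · rw [h21, ← Polynomial.map_map]
    exact h1.map _
  · rw [h12, ← Polynomial.map_map]
    exact h2.map _

/-- Pseudo-division of polynomials over a commutative ring. -/
theorem Polynomial.exists_pseudo_division {R : Type*} [CommRing R] [IsDomain R]
    (p : Polynomial R) (hp : p ≠ 0) (f : Polynomial R) :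
    ∃ (c : R) (q r : Polynomial R), c ≠ 0 ∧ Polynomial.C c * f = p * q + r ∧
      r.degree < p.degree := by
  induction hn : f.natDegree using Nat.strong_induction_on generalizing f with
  | _ n ih =>
  by_cases hlt : f.degree < p.degree
  · exact ⟨1, 0, f, one_ne_zero, by simp, hlt⟩
  have hf0 : f ≠ 0 := by
    rintro rfl
    exact hlt (by rw [Polynomial.degree_zero]; exact bot_lt_iff_ne_bot.2 (by simpa using hp))
  have hle : p.natDegree ≤ f.natDegree := Polynomial.natDegree_le_natDegree (not_lt.1 hlt)
  set g := Polynomial.C p.leadingCoeff * f -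
    p * (Polynomial.C f.leadingCoeff * Polynomial.X ^ (f.natDegree - p.natDegree)) with hg
  have hlp : p.leadingCoeff ≠ 0 := by simpa using hp
  have hlf : f.leadingCoeff ≠ 0 := by simpa using hf0
  have hgd : g.degree < f.degree := by
    have h1 : (Polynomial.C p.leadingCoeff * f).degree = f.degree := by
      rw [Polynomial.degree_mul, Polynomial.degree_C hlp, zero_add]
    rw [← h1]
    apply Polynomial.degree_sub_lt_left
    · rw [h1, Polynomial.degree_mul, Polynomial.degree_mul, Polynomial.degree_C hlf,
        Polynomial.degree_X_pow, Polynomial.degree_eq_natDegree hp,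
        Polynomial.degree_eq_natDegree hf0, zero_add, ← Nat.cast_add]
      congr 1
      omega
    · exact mul_ne_zero (by simpa using hp) hf0
    · rw [Polynomial.leadingCoeff_mul, Polynomial.leadingCoeff_mul, Polynomial.leadingCoeff_mul,
        Polynomial.leadingCoeff_C, Polynomial.leadingCoeff_C, Polynomial.leadingCoeff_X_pow,
        mul_one]
  by_cases hg0 : g = 0
  · refine ⟨p.leadingCoeff,
      Polynomial.C f.leadingCoeff * Polynomial.X ^ (f.natDegree - p.natDegree), 0, hlp, ?_, ?_⟩
    · rw [add_zero, ← sub_eq_zero, ← hg, hg0]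
    · rw [Polynomial.degree_zero]; exact bot_lt_iff_ne_bot.2 (by simpa using hp)
  obtain ⟨c, q, r, hc, hcg, hr⟩ := ih g.natDegree
    (hn ▸ Polynomial.natDegree_lt_natDegree hg0 hgd) g rfl
  refine ⟨c * p.leadingCoeff, Polynomial.C c *
    (Polynomial.C f.leadingCoeff * Polynomial.X ^ (f.natDegree - p.natDegree)) + q, r,
    mul_ne_zero hc hlp, ?_, hr⟩
  rw [hg] at hcg
  rw [map_mul]
  linear_combination hcg

theorem Polynomial.exists_prime_dvd_of_mem {R : Type*} [CommRing R] [IsDomain R]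
    [UniqueFactorizationMonoid R] (I : Ideal (Polynomial R)) [I.IsPrime]
    (hI : ∀ c, Polynomial.C c ∈ I → c = 0) (q : Polynomial R) (hq : q ∈ I) (hq0 : q ≠ 0) :
    ∃ P : Polynomial R, Prime P ∧ P ∈ I ∧ P.natDegree ≤ q.natDegree ∧ ∀ f ∈ I, P ∣ f := by
  classical
  have hex : ∃ n, ∃ p ∈ I, p ≠ 0 ∧ p.natDegree = n := ⟨_, q, hq, hq0, rfl⟩
  obtain ⟨p, hp, hp0, hpn⟩ := Nat.find_spec hex
  have hmin : ∀ f ∈ I, f ≠ 0 → p.natDegree ≤ f.natDegree := by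
    intro f hf hf0
    rw [hpn]
    exact Nat.find_min' hex ⟨f, hf, hf0, rfl⟩
  have hnu : ¬ IsUnit p := fun h => Ideal.IsPrime.ne_top ‹_› (Ideal.eq_top_of_isUnit_mem _ hp h)
  obtain ⟨P, hP, hPI, hPp⟩ : ∃ P, Prime P ∧ P ∈ I ∧ P ∣ p := by
    have hprod := UniqueFactorizationMonoid.factors_prod hp0
    have h1 : (UniqueFactorizationMonoid.factors p).prod ∈ I := by
      obtain ⟨u, hu⟩ := hprod
      rw [← hu] at hp
      exact (Ideal.IsPrime.mem_or_mem ‹_› hp).resolve_right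
        fun h => Ideal.IsPrime.ne_top ‹_› (Ideal.eq_top_of_isUnit_mem _ h u.isUnit)
    obtain ⟨P, hP, hPI⟩ := (Ideal.IsPrime.multiset_prod_mem_iff_exists_mem ‹_› _).1 h1
    exact ⟨P, UniqueFactorizationMonoid.prime_of_factor P hP, hPI,
      UniqueFactorizationMonoid.dvd_of_mem_factors hP⟩
  have hPd : P.natDegree ≤ p.natDegree := Polynomial.natDegree_le_of_dvd hPp hp0
  refine ⟨P, hP, hPI, hPd.trans (hmin q hq hq0), fun f hf => ?_⟩
  obtain ⟨c, s, r, hc, hcf, hr⟩ := Polynomial.exists_pseudo_division P hP.ne_zero f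
  have hrI : r ∈ I := by
    have h1 : r = Polynomial.C c * f - P * s := by rw [hcf]; ring
    rw [h1]
    exact I.sub_mem (I.mul_mem_left _ hf) (I.mul_mem_right _ hPI)
  have hr0 : r = 0 := by
    by_contra hr0
    have := Polynomial.natDegree_lt_natDegree hr0 hr
    have := hmin r hrI hr0
    omega
  rw [hr0, add_zero] at hcf
  refine (hP.dvd_or_dvd ⟨s, hcf⟩).resolve_left fun ⟨b, hb⟩ => ?_
  have h0 : P.natDegree = 0 := by
    have := congrArg Polynomial.natDegree hb
    have hb0 : b ≠ 0 := by
      rintro rfl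
      exact hc (by simpa using hb)
    rw [Polynomial.natDegree_mul hP.ne_zero hb0, Polynomial.natDegree_C] at this
    omega
  rw [Polynomial.eq_C_of_natDegree_eq_zero h0] at hPI hP
  exact hP.ne_zero (by rw [hI _ hPI, map_zero])

theorem MvPolynomial.exists_prime_dvd_of_mem {K : Type*} [Field K]
    (I : Ideal (MvPolynomial (Fin 3) K)) [I.IsPrime]
    (hI : ∀ c, degreeOf 0 c = 0 → c ∈ I → c = 0) (q : MvPolynomial (Fin 3) K) (hq : q ∈ I)
    (hq0 : q ≠ 0) :
    ∃ P : MvPolynomial (Fin 3) K, Prime P ∧ P ∈ I ∧ degreeOf 0 P ≤ degreeOf 0 q ∧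
      ∀ f ∈ I, P ∣ f := by
  let E := finSuccEquiv K 2
  have hprime : (I.comap E.symm).IsPrime := Ideal.comap_isPrime E.symm I
  obtain ⟨P, hP, hPI, hPd, hPf⟩ := Polynomial.exists_prime_dvd_of_mem (I.comap E.symm)
    (fun c hc => by
      have h1 : degreeOf 0 (E.symm (Polynomial.C c)) = 0 := by
        rw [← natDegree_finSuccEquiv]
        simp [E]
      have := hI _ h1 hc
      simpa using this) (E q) (by simpa using hq) (by simpa using hq0)
  refine ⟨E.symm P, (MulEquiv.prime_iff E.symm.toMulEquiv).2 hP, hPI, ?_, fun f hf => ?_⟩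
  · rw [← natDegree_finSuccEquiv, ← natDegree_finSuccEquiv]
    simpa [E] using hPd
  · have := hPf (E f) (by simpa using hf)
    simpa using map_dvd E.symm this

/-- The scaling `X i ↦ s ^ w i • X i`, with values in polynomials in `s`. -/
def scalingHom (K : Type*) [CommRing K] (w : Fin 3 → ℕ) :
    MvPolynomial (Fin 3) K →ₐ[K] Polynomial (MvPolynomial (Fin 3) K) :=
  aeval (fun i => Polynomial.C (X i) * Polynomial.X ^ w i)

theorem scalingHom_monomial {K : Type*} [CommRing K] (w : Fin 3 → ℕ) (m : Fin 3 →₀ ℕ) (c : K) :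
    scalingHom K w (monomial m c) =
      Polynomial.C (monomial m c) * Polynomial.X ^ (∑ i, m i * w i) := by
  rw [scalingHom, aeval_monomial, Finsupp.prod_fintype _ _ (by simp)]
  simp only [mul_pow, Finset.prod_mul_distrib, ← pow_mul, Finset.prod_pow_eq_pow_sum]
  rw [monomial_eq, Finsupp.prod_fintype _ _ (by simp), map_mul, map_prod]
  simp only [map_pow, mul_assoc, mul_comm (w _)]
  rfl

theorem coeff_coeff_scalingHom {K : Type*} [CommRing K] (w : Fin 3 → ℕ) (m : Fin 3 →₀ ℕ)
    (f : MvPolynomial (Fin 3) K) :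
    coeff m ((scalingHom K w f).coeff (∑ i, m i * w i)) = coeff m f := by
  induction f using MvPolynomial.induction_on' with
  | monomial n c =>
    rw [scalingHom_monomial, Polynomial.coeff_C_mul_X_pow]
    by_cases h : n = m
    · rw [h, if_pos rfl]
    · split_ifs
      · rfl
      · rw [coeff_monomial, if_neg h, coeff_zero]
  | add p q hp hq => rw [map_add, Polynomial.coeff_add, coeff_add, coeff_add, hp, hq]

theorem eval_one_scalingHom {K : Type*} [CommRing K] (w : Fin 3 → ℕ) (f : MvPolynomial (Fin 3) K) :
    (scalingHom K w f).eval 1 = f := by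
  induction f using MvPolynomial.induction_on' with
  | monomial n c => rw [scalingHom_monomial]; simp
  | add p q hp hq => rw [map_add, Polynomial.eval_add, hp, hq]

theorem exists_scalingHom_eq_of_mul {K : Type*} [Field K] (w : Fin 3 → ℕ)
    (f g : MvPolynomial (Fin 3) K) (hf : f ≠ 0) (hg : g ≠ 0) (n : ℕ)
    (h : scalingHom K w (f * g) = Polynomial.C (f * g) * Polynomial.X ^ n) :
    ∃ p, scalingHom K w f = Polynomial.C f * Polynomial.X ^ p := by
  have hne (q : MvPolynomial (Fin 3) K) (hq : q ≠ 0) : scalingHom K w q ≠ 0 := by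
    intro h0
    have := eval_one_scalingHom w q
    rw [h0, Polynomial.eval_zero] at this
    exact hq this.symm
  have h1 : (scalingHom K w f * scalingHom K w g).natDegree = n := by
    rw [← map_mul, h, Polynomial.natDegree_C_mul_X_pow n _ (mul_ne_zero hf hg)]
  have h2 : (scalingHom K w f * scalingHom K w g).natTrailingDegree = n := by
    rw [← map_mul, h, Polynomial.natTrailingDegree_mul_X_pow (by
      rw [Ne, Polynomial.C_eq_zero]; exact mul_ne_zero hf hg)]
    rw [Polynomial.natTrailingDegree_C, zero_add]
  rw [Polynomial.natDegree_mul (hne f hf) (hne g hg)] at h1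
  rw [Polynomial.natTrailingDegree_mul (hne f hf) (hne g hg)] at h2
  have h3 := Polynomial.natTrailingDegree_le_natDegree (scalingHom K w f)
  have h4 := Polynomial.natTrailingDegree_le_natDegree (scalingHom K w g)
  have h5 : (scalingHom K w f).natTrailingDegree = (scalingHom K w f).natDegree := by omega
  obtain ⟨c, hc⟩ : ∃ c, scalingHom K w f =
      Polynomial.C c * Polynomial.X ^ (scalingHom K w f).natDegree := by
    refine ⟨(scalingHom K w f).leadingCoeff, ?_⟩
    ext1 j
    rw [Polynomial.coeff_C_mul_X_pow]
    rcases lt_trichotomy j (scalingHom K w f).natDegree with hj | hj | hj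
    · rw [if_neg hj.ne]
      exact Polynomial.coeff_eq_zero_of_lt_natTrailingDegree (by omega)
    · rw [if_pos hj, hj]; rfl
    · rw [if_neg hj.ne']
      exact Polynomial.coeff_eq_zero_of_natDegree_lt hj
  generalize (scalingHom K w f).natDegree = p at hc
  refine ⟨p, hc.trans ?_⟩
  have h6 := eval_one_scalingHom w f
  rw [hc] at h6
  simp only [Polynomial.eval_mul, Polynomial.eval_C, Polynomial.eval_pow, Polynomial.eval_X,
    one_pow, mul_one] at h6
  rw [h6]

theorem weight_eq_of_scalingHom_eq {K : Type*} [Field K] (w : Fin 3 → ℕ)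
    (f : MvPolynomial (Fin 3) K) (p : ℕ)
    (h : scalingHom K w f = Polynomial.C f * Polynomial.X ^ p) (m : Fin 3 →₀ ℕ)
    (hm : m ∈ f.support) : ∑ i, m i * w i = p := by
  have h1 := coeff_coeff_scalingHom w m f
  rw [h, Polynomial.coeff_C_mul_X_pow] at h1
  split_ifs at h1 with h2
  · exact h2
  · rw [coeff_zero] at h1
    exact absurd h1.symm (mem_support_iff.1 hm)

theorem MvPolynomial.IsHomogeneous.aeval_mul_const {σ K A : Type*} [CommRing K] [CommRing A]
    [Algebra K A] {F : MvPolynomial σ K} {d : ℕ} (hF : F.IsHomogeneous d) (a : σ → A) (b : A) :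
    MvPolynomial.aeval (fun i => a i * b) F = MvPolynomial.aeval a F * b ^ d := by
  rw [aeval_def, aeval_def, eval₂_eq, eval₂_eq, Finset.sum_mul]
  refine Finset.sum_congr rfl fun m hm => ?_
  have hd : ∑ i ∈ m.support, m i = d := by
    have := hF (mem_support_iff.1 hm)
    rwa [Finsupp.weight_apply, Finsupp.sum, Finset.sum_congr rfl (fun i _ => by
      rw [Pi.one_apply, smul_eq_mul, mul_one])] at this
  simp only [mul_pow, Finset.prod_mul_distrib, Finset.prod_pow_eq_pow_sum, hd, mul_assoc]

theorem MvPolynomial.pderiv_aeval_eq_sum {K : Type*} [CommRing K]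
    (h : Fin 3 → MvPolynomial (Fin 3) K)
    (F : MvPolynomial (Fin 3) K) (j : Fin 3) :
    pderiv j (MvPolynomial.aeval h F) =
      ∑ i, MvPolynomial.aeval h (pderiv i F) * pderiv j (h i) := by
  induction F using MvPolynomial.induction_on with
  | C a => simp
  | add p q hp hq => simp only [map_add, hp, hq, add_mul, Finset.sum_add_distrib]
  | mul_X p n hp =>
    simp only [map_mul, pderiv_mul, hp, aeval_X, map_add, add_mul, Finset.sum_add_distrib]
    congr 1
    · rw [Finset.sum_mul]
      exact Finset.sum_congr rfl fun i _ => by ring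
    · rw [Finset.sum_eq_single n]
      · simp
      · intro i _ hi
        rw [pderiv_X_of_ne hi.symm]; simp
      · simp

theorem dvd_of_dvd_mul_of_isRelPrime {B : Type*} [CommRing B] [IsDomain B]
    [DecompositionMonoid B] (p x y s : B) (hp : p ≠ 0) (hxy : IsRelPrime x y) (h1 : p ∣ x * s)
    (h2 : p ∣ y * s) : p ∣ s := by
  obtain ⟨p1, p2, hp1, ⟨s', rfl⟩, rfl⟩ := exists_dvd_and_dvd_of_dvd_mul h1
  have hp2 : p2 ≠ 0 := right_ne_zero_of_mul hp
  have h3 : p1 ∣ y * s' := by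
    obtain ⟨c, hc⟩ := h2
    refine ⟨c, mul_left_cancel₀ hp2 ?_⟩
    linear_combination hc
  have h4 : p1 ∣ s' := (hxy.of_dvd_left hp1).dvd_of_dvd_mul_left h3
  rw [mul_comm p1 p2]
  exact mul_dvd_mul_left _ h4

theorem X_dvd_sub_aeval_update {K : Type*} [CommRing K] (j : Fin 3) (f : MvPolynomial (Fin 3) K) :
    X j ∣ f - aeval (Function.update X j 0) f := by
  induction f using MvPolynomial.induction_on with
  | C a => simp
  | add p q hp hq =>
    rw [map_add, add_sub_add_comm]
    exact dvd_add hp hq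
  | mul_X p n hp =>
    rw [map_mul, aeval_X]
    by_cases h : n = j
    · rw [h]; simp
    · rw [Function.update_of_ne h, ← sub_mul]
      exact hp.mul_right _

theorem mem_span_pair_of_saturated {K : Type*} [Field K] (P R V : MvPolynomial (Fin 3) K)
    (hP : Prime P) (hR : ¬ P ∣ R) (j : Fin 3) (hj : ¬ X j ∣ P) (a : Fin 3) (b : Fin 3)
    (haj : a ≠ j) (hbj : b ≠ j) (hab : a ≠ b) (N M : ℕ)
    (ha : V * X a ^ N ∈ Ideal.span {P, R}) (hb : V * X b ^ M ∈ Ideal.span {P, R})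
    (i : ℕ) (hi : V * X j ^ (i + 1) ∈ Ideal.span {P, R}) : V * X j ^ i ∈ Ideal.span {P, R} := by
  rw [Ideal.mem_span_pair] at *
  obtain ⟨T, S, h1⟩ := hi
  obtain ⟨T2, S2, h2⟩ := ha
  obtain ⟨T3, S3, h3⟩ := hb
  have key (x Ti Si : MvPolynomial (Fin 3) K) (h : Ti * P + Si * R = V * x) :
      P ∣ x * S - X j ^ (i + 1) * Si := by
    refine (hP.dvd_or_dvd (a := R) ⟨X j ^ (i + 1) * Ti - x * T, ?_⟩).resolve_left hR
    linear_combination x * h1 - X j ^ (i + 1) * h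
  let ev := aeval (R := K) (Function.update (X : Fin 3 → MvPolynomial (Fin 3) K) j 0)
  have hevX : ev (X j) = 0 := by simp [ev]
  have hevP : ev P ≠ 0 := by
    intro h0
    apply hj
    have := X_dvd_sub_aeval_update j P
    change X j ∣ P - ev P at this
    rwa [h0, sub_zero] at this
  have ka := map_dvd ev (key _ _ _ h2)
  have kb := map_dvd ev (key _ _ _ h3)
  have heva : ev (X a) = X a := by simp [ev, Function.update_of_ne haj]
  have hevb : ev (X b) = X b := by simp [ev, Function.update_of_ne hbj]
  simp only [map_sub, map_mul, map_pow, hevX, heva, hevb, zero_pow (Nat.succ_ne_zero i), zero_mul,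
    sub_zero] at ka kb
  have hrel : IsRelPrime (X a ^ N : MvPolynomial (Fin 3) K) (X b ^ M) := by
    apply IsRelPrime.pow
    rw [(MvPolynomial.X_prime (i := a)).irreducible.isRelPrime_iff_not_dvd]
    rw [X_dvd_X]
    simpa using hab
  obtain ⟨c, hc⟩ := dvd_of_dvd_mul_of_isRelPrime _ _ _ _ hevP hrel ka kb
  obtain ⟨s1, hs1⟩ := X_dvd_sub_aeval_update j S
  obtain ⟨p1, hp1⟩ := X_dvd_sub_aeval_update j P
  change S - ev S = _ at hs1
  change P - ev P = _ at hp1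
  have hS : S = P * c + X j * (s1 - p1 * c) := by
    linear_combination hs1 - c * hp1 + hc
  have hU : X j ∣ P * (T + R * c) := by
    refine ⟨V * X j ^ i - (s1 - p1 * c) * R, ?_⟩
    rw [pow_succ] at h1
    linear_combination h1 - R * hS
  obtain ⟨T', hT'⟩ := ((MvPolynomial.X_prime (i := j)).dvd_or_dvd hU).resolve_left hj
  refine ⟨T', s1 - p1 * c, mul_left_cancel₀ (MvPolynomial.X_ne_zero j) ?_⟩
  rw [pow_succ] at h1
  linear_combination h1 - R * hS - P * hT'

theorem coeff_aeval_pow_pow_X {K : Type*} [CommRing K] (e : ℕ) (he : e ≠ 0)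
    (F : MvPolynomial (Fin 3) K) (m : Fin 3 →₀ ℕ) :
    coeff (Finsupp.equivFunOnFinite.symm ![m 2, m 0 * e, m 1 * e])
      (aeval ![X 1 ^ e, X 2 ^ e, X 0] F : MvPolynomial (Fin 3) K) = coeff m F := by
  induction F using MvPolynomial.induction_on' with
  | monomial n c =>
    have h : (aeval ![X 1 ^ e, X 2 ^ e, X 0] (monomial n c) : MvPolynomial (Fin 3) K) =
        monomial (Finsupp.equivFunOnFinite.symm ![n 2, n 0 * e, n 1 * e]) c := by
      rw [aeval_monomial, Finsupp.prod_fintype _ _ (by simp), monomial_eq,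
        Finsupp.prod_fintype _ _ (by simp), Fin.prod_univ_three, Fin.prod_univ_three]
      simp only [algebraMap_eq, Matrix.cons_val_zero, Matrix.cons_val_one, Matrix.cons_val,
        Finsupp.equivFunOnFinite_symm_apply_apply, ← pow_mul, mul_comm e]
      ring
    rw [h, coeff_monomial, coeff_monomial]
    congr 1
    refine propext ⟨fun h => ?_, fun h => by rw [h]⟩
    have h0 := DFunLike.congr_fun h 0
    have h1 := DFunLike.congr_fun h 1
    have h2 := DFunLike.congr_fun h 2
    simp only [Finsupp.equivFunOnFinite_symm_apply_apply, Matrix.cons_val_zero,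
      Matrix.cons_val_one, Matrix.cons_val, Nat.mul_left_inj he] at h0 h1 h2
    ext i
    fin_cases i
    · exact h1
    · exact h2
    · exact h0
  | add p q hp hq => rw [map_add, coeff_add, coeff_add, hp, hq]

/-- Homogenisation of a univariate polynomial in the variables `X 1`, `X 2`. -/
def homogenizeFin (K : Type*) [CommRing K] (M : ℕ) (A : Polynomial K) : MvPolynomial (Fin 3) K :=
  ∑ i ∈ Finset.range (M + 1), C (A.coeff i) * (X 1 ^ i * X 2 ^ (M - i))

theorem aeval_homogenizeFin {K S : Type*} [CommRing K] [CommRing S] [Algebra K S] (M : ℕ)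
    (A : Polynomial K) (hA : A.natDegree ≤ M) (x y z : S) :
    aeval ![z, x * y, y] (homogenizeFin K M A) = Polynomial.aeval x A * y ^ M := by
  rw [homogenizeFin, map_sum, Polynomial.aeval_eq_sum_range' (Nat.lt_succ_of_le hA),
    Finset.sum_mul]
  refine Finset.sum_congr rfl fun i hi => ?_
  have : M = i + (M - i) := by have := Finset.mem_range.1 hi; omega
  conv_rhs => rw [this]
  simp only [map_mul, map_pow, aeval_X, aeval_C, Matrix.cons_val_one, Matrix.cons_val,
    Algebra.smul_def]
  ring

theorem degreeOf_homogenizeFin {K : Type*} [Field K] (M : ℕ) (A : Polynomial K) :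
    degreeOf 0 (homogenizeFin K M A) = 0 := by
  rw [← Nat.le_zero]
  refine (degreeOf_sum_le _ _ _).trans (Finset.sup_le fun i _ => ?_)
  refine (degreeOf_mul_le _ _ _).trans ?_
  rw [degreeOf_C, zero_add]
  refine (degreeOf_mul_le _ _ _).trans ?_
  have h1 := degreeOf_pow_le 0 (X 1 : MvPolynomial (Fin 3) K) i
  have h2 := degreeOf_pow_le 0 (X 2 : MvPolynomial (Fin 3) K) (M - i)
  rw [degreeOf_X_of_ne (by decide : (0 : Fin 3) ≠ 1)] at h1
  rw [degreeOf_X_of_ne (by decide : (0 : Fin 3) ≠ 2)] at h2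
  omega

theorem eq_zero_of_aeval_eq_zero_of_degreeOf {K Ω : Type*} [Field K] [CommRing Ω] [IsDomain Ω]
    [Algebra K Ω] (u : Ω) (hu : Transcendental K u) (z : Polynomial Ω)
    (c : MvPolynomial (Fin 3) K) (hc : degreeOf 0 c = 0)
    (h : aeval ![z, Polynomial.C u * Polynomial.X, Polynomial.X] c = 0) : c = 0 := by
  have h0 : ∀ m ∈ c.support, m 0 = 0 := fun m hm =>
    Nat.le_zero.1 (hc ▸ monomial_le_degreeOf 0 hm)
  have h1 : aeval ![z, Polynomial.C u * Polynomial.X, Polynomial.X] c =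
      ∑ m ∈ c.support, Polynomial.C (algebraMap K Ω (coeff m c) * u ^ m 1) *
        Polynomial.X ^ (m 1 + m 2) := by
    rw [aeval_def, eval₂_eq']
    refine Finset.sum_congr rfl fun m hm => ?_
    rw [Fin.prod_univ_three, h0 m hm]
    simp only [Matrix.cons_val_zero, Matrix.cons_val_one, Matrix.cons_val, pow_zero, one_mul,
      map_mul, map_pow, mul_pow, pow_add]
    rw [IsScalarTower.algebraMap_apply K Ω (Polynomial Ω)]
    change Polynomial.C _ * _ = _
    ring
  ext n
  rw [coeff_zero]
  let p : Polynomial K := ∑ m ∈ c.support,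
    if n 1 + n 2 = m 1 + m 2 then Polynomial.monomial (m 1) (coeff m c) else 0
  have hp : Polynomial.aeval u p = 0 := by
    have h2 := congrArg (Polynomial.coeff · (n 1 + n 2)) (h1.symm.trans h)
    simp only [Polynomial.finsetSum_coeff, Polynomial.coeff_C_mul_X_pow,
      Polynomial.coeff_zero] at h2
    rw [map_sum, ← h2]
    refine Finset.sum_congr rfl fun m _ => ?_
    split_ifs
    · rw [Polynomial.aeval_monomial]
    · rw [map_zero]
  have hp0 : p = 0 := (transcendental_iff.1 hu) p hp
  by_contra hn
  have hns : n ∈ c.support := mem_support_iff.2 hn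
  have h3 : p.coeff (n 1) = coeff n c := by
    simp only [p, Polynomial.finsetSum_coeff]
    rw [Finset.sum_eq_single n]
    · simp
    · intro m hm hmn
      split_ifs with h4
      · rw [Polynomial.coeff_monomial, if_neg]
        intro h5
        apply hmn
        ext i
        fin_cases i
        · exact (h0 m hm).trans (h0 n hns).symm
        · exact h5
        · change m 2 = n 2
          omega
      · simp
    · intro h; exact absurd hns h
  rw [hp0, Polynomial.coeff_zero] at h3
  exact hn h3.symm

theorem mem_span_pair_of_forall_pow_mem {K : Type*} [Field K] [CharZero K]
    (F : MvPolynomial (Fin 3) K) (N : ℕ)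
    (hN : ∀ i, X i ^ N ∈ Ideal.span (Set.range fun j => pderiv j F)) (e : ℕ) (he : e ≠ 0)
    (P R : MvPolynomial (Fin 3) K) (hPR : aeval ![X 1 ^ e, X 2 ^ e, X 0] F = P * R) (i : Fin 3) :
    (X 1 ^ (e - 1) * X 2 ^ (e - 1)) * (![X 1 ^ e, X 2 ^ e, X 0] i) ^ N ∈ Ideal.span {P, R} := by
  set h : Fin 3 → MvPolynomial (Fin 3) K := ![X 1 ^ e, X 2 ^ e, X 0] with hh
  have hd (j : Fin 3) : pderiv j (aeval h F) ∈ Ideal.span {P, R} := by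
    rw [hPR, pderiv_mul]
    exact Ideal.add_mem _ (Ideal.mul_mem_left _ _ (Ideal.subset_span (by simp)))
      (Ideal.mul_mem_right _ _ (Ideal.subset_span (by simp)))
  have heu : IsUnit ((e : MvPolynomial (Fin 3) K)) := by
    have : IsUnit (C (e : K) : MvPolynomial (Fin 3) K) :=
      (IsUnit.mk0 (e : K) (by exact_mod_cast he)).map C
    simpa using this
  have hpow (a b : Fin 3) : pderiv a (X b ^ e : MvPolynomial (Fin 3) K) =
      if a = b then (e : MvPolynomial (Fin 3) K) * X b ^ (e - 1) else 0 := by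
    rw [pderiv_pow]
    split_ifs with hab
    · rw [hab, pderiv_X_self, mul_one]
    · rw [pderiv_X_of_ne (Ne.symm hab), mul_zero]
  have hD (j : Fin 3) : (X 1 ^ (e - 1) * X 2 ^ (e - 1)) * aeval h (pderiv j F) ∈
      Ideal.span {P, R} := by
    fin_cases j
    · have := hd 1
      rw [pderiv_aeval_eq_sum, Fin.sum_univ_three] at this
      simp only [hh, Matrix.cons_val_zero, Matrix.cons_val_one, Matrix.cons_val, hpow] at this
      rw [pderiv_X_of_ne (by decide), if_pos True.intro, if_neg (by decide), mul_zero, mul_zero,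
        add_zero,
        add_zero, mul_left_comm, Ideal.unit_mul_mem_iff_mem _ heu] at this
      convert Ideal.mul_mem_left _ (X 2 ^ (e - 1)) this using 1
      simp only [Fin.zero_eta]
      ring
    · have := hd 2
      rw [pderiv_aeval_eq_sum, Fin.sum_univ_three] at this
      simp only [hh, Matrix.cons_val_zero, Matrix.cons_val_one, Matrix.cons_val, hpow] at this
      rw [pderiv_X_of_ne (by decide), if_pos True.intro, if_neg (by decide), mul_zero, mul_zero,
        add_zero,
        zero_add, mul_left_comm, Ideal.unit_mul_mem_iff_mem _ heu] at this
      convert Ideal.mul_mem_left _ (X 1 ^ (e - 1)) this using 1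
      simp only [Fin.mk_one]
      ring
    · have := hd 0
      rw [pderiv_aeval_eq_sum, Fin.sum_univ_three] at this
      simp only [hh, Matrix.cons_val_zero, Matrix.cons_val_one, Matrix.cons_val, hpow] at this
      rw [pderiv_X_self, if_neg (by decide), if_neg (by decide), mul_zero, mul_zero, zero_add,
        zero_add, mul_one] at this
      exact Ideal.mul_mem_left _ _ this
  obtain ⟨c, hc⟩ := (Ideal.mem_span_range_iff_exists_fun).1 (hN i)
  have h2 := congrArg (aeval h) hc
  rw [map_pow, aeval_X, map_sum] at h2
  rw [← h2, Finset.mul_sum]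
  refine Ideal.sum_mem _ fun j _ => ?_
  rw [map_mul, mul_left_comm]
  exact Ideal.mul_mem_left _ _ (hD j)

theorem aeval_aeval_pow_pow_X_eq_zero {K Ω : Type*} [Field K] [CommRing Ω]
    [Algebra K Ω] (d : ℕ) (F : MvPolynomial (Fin 3) K) (hF : F.IsHomogeneous d) (e : ℕ)
    (u ζ : Ω) (hζ : aeval ![u ^ e, 1, ζ] F = 0) :
    aeval ![Polynomial.C ζ * Polynomial.X ^ e, Polynomial.C u * Polynomial.X, Polynomial.X]
      (aeval ![X 1 ^ e, X 2 ^ e, X 0] F : MvPolynomial (Fin 3) K) = (0 : Polynomial Ω) := by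
  have h1 : aeval ![Polynomial.C ζ * Polynomial.X ^ e, Polynomial.C u * Polynomial.X, Polynomial.X]
      (aeval ![X 1 ^ e, X 2 ^ e, X 0] F : MvPolynomial (Fin 3) K) =
      aeval (fun i => Polynomial.C (![u ^ e, 1, ζ] i) * Polynomial.X ^ e) F := by
    rw [comp_aeval_apply]
    congr 1
    congr 1
    funext i
    fin_cases i <;> simp [mul_pow]
  have h2 : aeval (fun i => Polynomial.C (![u ^ e, 1, ζ] i)) F =
      Polynomial.C (aeval ![u ^ e, 1, ζ] F) :=
    MvPolynomial.aeval_algebraMap_apply (Polynomial Ω) ![u ^ e, 1, ζ] F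
  rw [h1, hF.aeval_mul_const, h2, hζ, map_zero, zero_mul]

theorem scalingHom_aeval_pow_pow_X {K : Type*} [Field K] (d : ℕ) (F : MvPolynomial (Fin 3) K)
    (hF : F.IsHomogeneous d) (e : ℕ) :
    scalingHom K ![e, 1, 1] (aeval ![X 1 ^ e, X 2 ^ e, X 0] F) =
      Polynomial.C (aeval ![X 1 ^ e, X 2 ^ e, X 0] F) * Polynomial.X ^ (e * d) := by
  have h1 : scalingHom K ![e, 1, 1] (aeval ![X 1 ^ e, X 2 ^ e, X 0] F) =
      aeval (fun i => Polynomial.C ((![X 1 ^ e, X 2 ^ e, X 0] : Fin 3 → MvPolynomial (Fin 3) K) i) *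
        Polynomial.X ^ e) F := by
    have h0 (i : Fin 3) : scalingHom K ![e, 1, 1]
        ((![X 1 ^ e, X 2 ^ e, X 0] : Fin 3 → MvPolynomial (Fin 3) K) i) =
        Polynomial.C ((![X 1 ^ e, X 2 ^ e, X 0] : Fin 3 → MvPolynomial (Fin 3) K) i) *
          Polynomial.X ^ e := by
      have hX (j : Fin 3) : scalingHom K ![e, 1, 1] (X j) =
          Polynomial.C (X j) * Polynomial.X ^ (![e, 1, 1] : Fin 3 → ℕ) j := aeval_X _ _
      fin_cases i
      · change scalingHom K ![e, 1, 1] (X 1 ^ e) = Polynomial.C (X 1 ^ e) * _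
        rw [map_pow, hX, mul_pow, map_pow, ← pow_mul]
        simp
      · change scalingHom K ![e, 1, 1] (X 2 ^ e) = Polynomial.C (X 2 ^ e) * _
        rw [map_pow, hX, mul_pow, map_pow, ← pow_mul]
        simp
      · exact hX 0
    rw [comp_aeval_apply, funext h0]
  have h2 : aeval (fun i => Polynomial.C
      ((![X 1 ^ e, X 2 ^ e, X 0] : Fin 3 → MvPolynomial (Fin 3) K) i)) F =
      Polynomial.C (aeval ![X 1 ^ e, X 2 ^ e, X 0] F) :=
    MvPolynomial.aeval_algebraMap_apply (Polynomial (MvPolynomial (Fin 3) K)) _ F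
  rw [h1, hF.aeval_mul_const, ← pow_mul, h2]

theorem exists_quadratic_homogenization {K Ω : Type*} [Field K] [CommRing Ω]
    [Algebra K Ω] (e : ℕ) (u ζ : Ω) (A₂ A₁ A₀ : Polynomial K) (hA : A₂ ≠ 0)
    (hq : Polynomial.aeval u A₂ * ζ ^ 2 + Polynomial.aeval u A₁ * ζ + Polynomial.aeval u A₀ = 0) :
    ∃ q : MvPolynomial (Fin 3) K,
      aeval ![Polynomial.C ζ * Polynomial.X ^ e, Polynomial.C u * Polynomial.X, Polynomial.X] q =
        (0 : Polynomial Ω) ∧ q ≠ 0 ∧ degreeOf 0 q ≤ 2 := by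
  let φ : MvPolynomial (Fin 3) K →ₐ[K] Polynomial Ω :=
    aeval ![Polynomial.C ζ * Polynomial.X ^ e, Polynomial.C u * Polynomial.X, Polynomial.X]
  have hφ0 : φ (X 0) = Polynomial.C ζ * Polynomial.X ^ e := by simp [φ]
  have hφ2 : φ (X 2) = Polynomial.X := by simp [φ]
  obtain ⟨M, hM2, hM1, hM0⟩ : ∃ M, A₂.natDegree ≤ M ∧ A₁.natDegree ≤ M ∧ A₀.natDegree ≤ M :=
    ⟨max A₂.natDegree (max A₁.natDegree A₀.natDegree), by simp, by simp, by simp⟩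
  let q : MvPolynomial (Fin 3) K := homogenizeFin K M A₂ * X 0 ^ 2 +
    homogenizeFin K M A₁ * X 2 ^ e * X 0 + homogenizeFin K M A₀ * X 2 ^ (2 * e)
  have hqI : φ q = 0 := by
    have e2 : φ (homogenizeFin K M A₂) = _ := aeval_homogenizeFin M A₂ hM2 _ _ _
    have e1 : φ (homogenizeFin K M A₁) = _ := aeval_homogenizeFin M A₁ hM1 _ _ _
    have e0 : φ (homogenizeFin K M A₀) = _ := aeval_homogenizeFin M A₀ hM0 _ _ _
    have hC (A : Polynomial K) : Polynomial.aeval (Polynomial.C u) A =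
        Polynomial.C (Polynomial.aeval u A) :=
      Polynomial.aeval_algebraMap_apply (Polynomial Ω) u A
    rw [hC] at e2 e1 e0
    have h3 := congrArg (fun x => (Polynomial.C x : Polynomial Ω)) hq
    simp only [map_add, map_mul, map_pow, map_zero] at h3
    simp only [q, map_add, map_mul, map_pow, e2, e1, e0, hφ0, hφ2]
    rw [two_mul, pow_add]
    linear_combination (Polynomial.X ^ M * Polynomial.X ^ e * Polynomial.X ^ e) * h3
  have hq0 : q ≠ 0 := by
    intro h0
    let ψ : MvPolynomial (Fin 3) K →ₐ[K] Polynomial (Polynomial K) :=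
      aeval ![Polynomial.X, Polynomial.C Polynomial.X * 1, 1]
    have e2 : ψ (homogenizeFin K M A₂) = _ := aeval_homogenizeFin M A₂ hM2 _ _ _
    have e1 : ψ (homogenizeFin K M A₁) = _ := aeval_homogenizeFin M A₁ hM1 _ _ _
    have e0 : ψ (homogenizeFin K M A₀) = _ := aeval_homogenizeFin M A₀ hM0 _ _ _
    have hC (A : Polynomial K) : Polynomial.aeval (Polynomial.C (Polynomial.X : Polynomial K)) A =
        Polynomial.C A := by
      have := Polynomial.aeval_algebraMap_apply (Polynomial (Polynomial K))
        (Polynomial.X : Polynomial K) A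
      rw [Polynomial.aeval_X_left_apply] at this
      exact this
    rw [hC, one_pow, mul_one] at e2 e1 e0
    have hψ0 : ψ (X 0) = Polynomial.X := by simp [ψ]
    have hψ2 : ψ (X 2) = 1 := by simp [ψ]
    have h1 : ψ q = Polynomial.C A₂ * Polynomial.X ^ 2 + Polynomial.C A₁ * Polynomial.X +
        Polynomial.C A₀ := by
      simp only [q, map_add, map_mul, map_pow, e2, e1, e0, hψ0, hψ2, one_pow, mul_one]
    rw [h0, map_zero] at h1
    have h2 := congrArg (Polynomial.coeff · 2) h1
    simp only [Polynomial.coeff_zero, Polynomial.coeff_add, Polynomial.coeff_C_mul_X_pow,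
      Polynomial.coeff_C_mul_X, Polynomial.coeff_C, if_true] at h2
    simp at h2
    exact hA h2.symm
  have hqd : degreeOf 0 q ≤ 2 := by
    have hX0 : degreeOf 0 (X 0 : MvPolynomial (Fin 3) K) ≤ 1 := by rw [degreeOf_X_self]
    have hX2 (n : ℕ) : degreeOf 0 (X 2 ^ n : MvPolynomial (Fin 3) K) = 0 := by
      have := degreeOf_pow_le 0 (X 2 : MvPolynomial (Fin 3) K) n
      rw [degreeOf_X_of_ne (by decide : (0 : Fin 3) ≠ 2)] at this
      omega
    have d2 := degreeOf_homogenizeFin M A₂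
    have d1 := degreeOf_homogenizeFin M A₁
    have d0 := degreeOf_homogenizeFin M A₀
    have t1 := degreeOf_pow_le 0 (X 0 : MvPolynomial (Fin 3) K) 2
    have t2 := degreeOf_mul_le 0 (homogenizeFin K M A₂) (X 0 ^ 2)
    have t3 := degreeOf_mul_le 0 (homogenizeFin K M A₁ * X 2 ^ e) (X 0)
    have t4 := degreeOf_mul_le 0 (homogenizeFin K M A₁) (X 2 ^ e)
    have t5 := degreeOf_mul_le 0 (homogenizeFin K M A₀) (X 2 ^ (2 * e))
    rw [hX2] at t4 t5
    refine (degreeOf_add_le _ _ _).trans (max_le ((degreeOf_add_le _ _ _).trans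
      (max_le ?_ ?_)) ?_) <;> omega
  exact ⟨q, hqI, hq0, hqd⟩

theorem false_of_quadratic_over_rational {K Ω : Type*} [Field K] [CharZero K] [CommRing Ω]
    [IsDomain Ω] [Algebra K Ω] (d : ℕ) (hd5 : 5 ≤ d) (F : MvPolynomial (Fin 3) K)
    (hF : F.IsHomogeneous d) (N : ℕ)
    (hN : ∀ i, X i ^ N ∈ Ideal.span (Set.range fun j => pderiv j F))
    (m : Fin 3 →₀ ℕ) (hm : d - 1 ≤ m 2) (hmF : coeff m F ≠ 0) (e : ℕ) (he : e ≠ 0)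
    (u ζ : Ω) (hu : Transcendental K u) (hζ : aeval ![u ^ e, 1, ζ] F = 0)
    (A₂ A₁ A₀ : Polynomial K) (hA : A₂ ≠ 0)
    (hq : Polynomial.aeval u A₂ * ζ ^ 2 + Polynomial.aeval u A₁ * ζ + Polynomial.aeval u A₀ = 0) :
    False := by
  set h : Fin 3 → MvPolynomial (Fin 3) K := ![X 1 ^ e, X 2 ^ e, X 0] with hh
  let φ : MvPolynomial (Fin 3) K →ₐ[K] Polynomial Ω :=
    aeval ![Polynomial.C ζ * Polynomial.X ^ e, Polynomial.C u * Polynomial.X, Polynomial.X]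
  let I := RingHom.ker φ
  have hI : I.IsPrime := RingHom.ker_isPrime φ
  have hφ0 : φ (X 0) = Polynomial.C ζ * Polynomial.X ^ e := by simp [φ]
  have hφ1 : φ (X 1) = Polynomial.C u * Polynomial.X := by simp [φ]
  have hφ2 : φ (X 2) = Polynomial.X := by simp [φ]
  have hG : aeval h F ∈ I := aeval_aeval_pow_pow_X_eq_zero d F hF e u ζ hζ
  obtain ⟨q, hqI, hq0, hqd⟩ := exists_quadratic_homogenization e u ζ A₂ A₁ A₀ hA hq
  obtain ⟨P, hP, hPI, hPd, hPf⟩ := MvPolynomial.exists_prime_dvd_of_mem I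
    (fun c hc hcI => eq_zero_of_aeval_eq_zero_of_degreeOf u hu _ c hc hcI) q hqI hq0
  obtain ⟨R, hPR⟩ := hPf _ hG
  have hGc : coeff (Finsupp.equivFunOnFinite.symm ![m 2, m 0 * e, m 1 * e]) (aeval h F) ≠ 0 := by
    rw [hh, coeff_aeval_pow_pow_X e he F m]; exact hmF
  have hG0 : aeval h F ≠ 0 := by
    intro h0
    rw [h0, coeff_zero] at hGc
    exact hGc rfl
  have hR0 : R ≠ 0 := by
    rintro rfl
    rw [mul_zero] at hPR
    exact hG0 hPR
  have hRd : 2 ≤ degreeOf 0 R := by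
    have h1 := monomial_le_degreeOf 0 (mem_support_iff.2 hGc)
    rw [hPR, degreeOf_mul_eq hP.ne_zero hR0] at h1
    simp only [Finsupp.equivFunOnFinite_symm_apply_apply, Matrix.cons_val_zero] at h1
    omega
  let w : Fin 3 → ℕ := ![e, 1, 1]
  have hScG : scalingHom K w (P * R) = Polynomial.C (P * R) * Polynomial.X ^ (e * d) := by
    rw [← hPR]
    exact scalingHom_aeval_pow_pow_X d F hF e
  obtain ⟨p, hp⟩ := exists_scalingHom_eq_of_mul w P R hP.ne_zero hR0 _ hScG
  obtain ⟨ρ, hρ⟩ := exists_scalingHom_eq_of_mul w R P hR0 hP.ne_zero (e * d)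
    (by rw [mul_comm R P]; exact hScG)
  have hρe : 2 * e ≤ ρ := by
    obtain ⟨n, hn, hnd⟩ : ∃ n ∈ R.support, n 0 = degreeOf 0 R := by
      rw [degreeOf_eq_sup]
      obtain ⟨n, hn, h1⟩ := Finset.exists_mem_eq_sup R.support (support_nonempty.2 hR0)
        (fun n => n 0)
      exact ⟨n, hn, h1.symm⟩
    have h1 := weight_eq_of_scalingHom_eq w R ρ hρ n hn
    rw [Fin.sum_univ_three] at h1
    simp only [w, Matrix.cons_val_zero, Matrix.cons_val_one, Matrix.cons_val] at h1
    rw [← h1, hnd]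
    have := Nat.mul_le_mul_right e hRd
    omega
  have hmem := mem_span_pair_of_forall_pow_mem F N hN e he P R hPR
  have hu0 : u ≠ 0 := by
    rintro rfl
    exact hu isAlgebraic_zero
  have hVI (a b : ℕ) : X 1 ^ a * X 2 ^ b ∉ I := by
    intro hmem
    have h1 : φ (X 1 ^ a * X 2 ^ b) = 0 := hmem
    rw [map_mul, map_pow, map_pow, hφ1, hφ2, mul_eq_zero] at h1
    rcases h1 with h1 | h1
    · exact pow_ne_zero a (mul_ne_zero (by simpa using hu0) Polynomial.X_ne_zero) h1
    · exact pow_ne_zero b Polynomial.X_ne_zero h1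
  have hPR' : ¬ P ∣ R := by
    intro hdvd
    have h1 : Ideal.span {P, R} ≤ I := by
      rw [Ideal.span_le]
      rintro x (rfl | rfl)
      · exact hPI
      · exact I.mem_of_dvd hdvd hPI
    have h2 := h1 (hmem 0)
    simp only [Matrix.cons_val_zero, ← pow_mul] at h2
    rw [mul_right_comm, ← pow_add] at h2
    exact hVI _ _ h2
  have hjP : ¬ X 1 ∣ P := by
    intro hdvd
    have h1 : P ∣ X 1 := (MvPolynomial.X_prime.dvd_prime_iff_associated hP).1 hdvd |>.symm.dvd
    have h2 := I.mem_of_dvd h1 hPI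
    have := hVI 1 0
    simp only [pow_one, pow_zero, mul_one] at this
    exact this h2
  have hV : ∀ i, (X 1 ^ (e - 1) * X 2 ^ (e - 1)) * X 1 ^ i ∈ Ideal.span {P, R} →
      X 1 ^ (e - 1) * X 2 ^ (e - 1) ∈ Ideal.span {P, R} := by
    intro i
    induction i with
    | zero => intro h; simpa using h
    | succ i ih =>
      intro hi
      apply ih
      apply mem_span_pair_of_saturated P R _ hP hPR' 1 hjP 0 2 (by decide) (by decide) (by decide)
        N (e * N) _ _ i hi
      · exact hmem 2
      · have := hmem 1
        simp only [Matrix.cons_val_one, Matrix.cons_val_zero, ← pow_mul] at this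
        exact this
  have hVm := hV (e * N) (by
    have := hmem 0
    simp only [Matrix.cons_val_zero, ← pow_mul] at this
    exact this)
  obtain ⟨T, S, hTS⟩ := Ideal.mem_span_pair.1 hVm
  have hsc := congrArg (scalingHom K w) hTS
  have hX1 : scalingHom K w (X 1) = Polynomial.C (X 1) * Polynomial.X := by
    simp [scalingHom, w]
  have hX2 : scalingHom K w (X 2) = Polynomial.C (X 2) * Polynomial.X := by
    simp [scalingHom, w]
  rw [map_add, map_mul, map_mul, hp, hρ, map_mul, map_pow, map_pow, hX1, hX2] at hsc
  have hsc' : Polynomial.C P * (scalingHom K w T * Polynomial.X ^ p) +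
      (scalingHom K w S * Polynomial.C R) * Polynomial.X ^ ρ =
      Polynomial.C (X 1 ^ (e - 1) * X 2 ^ (e - 1)) * Polynomial.X ^ ((e - 1) + (e - 1)) := by
    rw [map_mul, map_pow, map_pow, pow_add]
    linear_combination hsc
  have hco := congrArg (Polynomial.coeff · (e - 1 + (e - 1))) hsc'
  simp only [Polynomial.coeff_add, Polynomial.coeff_C_mul, Polynomial.coeff_X_pow,
    Polynomial.coeff_mul_X_pow' _ ρ] at hco
  rw [if_neg (by omega), add_zero, if_pos True.intro, mul_one] at hco
  apply hVI (e - 1) (e - 1)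
  rw [← hco]
  exact I.mul_mem_right _ hPI

/-- A Liouville type inequality for an absolute value: nonzero algebraic integers of bounded degree
and bounded conjugates are not too small. -/
def HasLiouvilleBound {K : Type*} [Field K] [CharZero K] (v : AbsoluteValue K ℝ) : Prop :=
  ∀ (D : ℕ) (C : ℝ) (y : K), 1 ≤ C → IsIntegral ℤ y → y ≠ 0 → (minpoly ℚ y).natDegree ≤ D →
    (∀ σ : K →+* ℂ, ‖σ y‖ ≤ C) → 1 ≤ C ^ (D + 1) * v y

theorem norm_coeff_zero_minpoly_le {K L : Type*} [Field K] [CharZero K] [NormedField L]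
    [CharZero L] [IsAlgClosed L] (ι : K →+* L) (y : K) (hy : IsIntegral ℚ y) (B : ℝ) (hB : 1 ≤ B)
    (h : ∀ x ∈ (minpoly ℚ y).aroots L, ‖x‖ ≤ B) :
    ‖((minpoly ℚ y).coeff 0 : L)‖ ≤ B ^ (minpoly ℚ y).natDegree * ‖ι y‖ := by
  have hm := minpoly.monic hy
  have hroot : ι y ∈ (minpoly ℚ y).aroots L := by
    rw [Polynomial.mem_aroots]
    refine ⟨hm.ne_zero, ?_⟩
    have h1 := minpoly.aeval ℚ y
    have h2 := congrArg ι h1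
    rw [map_zero, Polynomial.aeval_def, Polynomial.hom_eval₂] at h2
    rw [Polynomial.aeval_def, ← h2]
    congr 1
    exact Subsingleton.elim _ _
  have h1 := (IsAlgClosed.splits
    ((minpoly ℚ y).map (algebraMap ℚ L))).coeff_zero_eq_prod_roots_of_monic
    (hm.map _)
  have hcard := (IsAlgClosed.splits ((minpoly ℚ y).map (algebraMap ℚ L))).natDegree_eq_card_roots
  rw [Polynomial.natDegree_map] at hcard
  obtain ⟨s, hs⟩ := Multiset.exists_cons_of_mem hroot
  rw [Polynomial.aroots] at hs h
  rw [hs] at h1 h hcard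
  rw [Polynomial.coeff_map, eq_ratCast] at h1
  rw [h1, norm_mul, norm_pow, norm_neg, norm_one, one_pow, one_mul, Multiset.prod_cons, norm_mul,
    mul_comm, hcard]
  refine mul_le_mul_of_nonneg_right ?_ (norm_nonneg _)
  have key (s : Multiset L) (hs : ∀ x ∈ s, ‖x‖ ≤ B) : ‖s.prod‖ ≤ B ^ s.card := by
    induction s using Multiset.induction_on with
    | empty => simp
    | cons a s ih =>
      rw [Multiset.prod_cons, norm_mul, Multiset.card_cons, pow_succ']
      exact mul_le_mul (hs a (by simp)) (ih fun x hx => hs x (by simp [hx])) (norm_nonneg _)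
        (by linarith)
  refine (key s fun x hx => h x (by simp [hx])).trans ?_
  exact pow_le_pow_right₀ hB (by simp)

theorem exists_ringHom_apply_eq_of_mem_aroots {K L : Type*} [Field K] [CharZero K]
    [Algebra.IsAlgebraic ℚ K] [Field L] [CharZero L] [IsAlgClosed L] (y : K) (x : L)
    (hx : x ∈ (minpoly ℚ y).aroots L) : ∃ σ : K →+* L, σ y = x := by
  have h := Algebra.IsAlgebraic.range_eval_eq_rootSet_minpoly (F := ℚ) L y
  have hx' : x ∈ (minpoly ℚ y).rootSet L := by
    rw [Polynomial.mem_rootSet]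
    rw [Polynomial.mem_aroots] at hx
    exact hx
  rw [← h] at hx'
  obtain ⟨σ, hσ⟩ := hx'
  exact ⟨σ.toRingHom, hσ⟩

theorem exists_int_eq_coeff_zero_minpoly {K : Type*} [Field K] [CharZero K] (y : K)
    (hy : IsIntegral ℤ y) (hy0 : y ≠ 0) : ∃ b : ℤ, b ≠ 0 ∧ (minpoly ℚ y).coeff 0 = b := by
  have h := minpoly.isIntegrallyClosed_eq_field_fractions' ℚ hy
  have h0 := minpoly.coeff_zero_ne_zero (hy.tower_top (A := ℚ)) hy0
  refine ⟨(minpoly ℤ y).coeff 0, ?_, by rw [h, Polynomial.coeff_map, eq_intCast]⟩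
  intro hb
  rw [h, Polynomial.coeff_map, hb, map_zero] at h0
  exact h0 rfl

theorem abs_coeff_zero_minpoly_le {K : Type*} [Field K] [CharZero K] [Algebra.IsAlgebraic ℚ K]
    (σ : K →+* ℂ) (y : K) (C : ℝ) (hC : 1 ≤ C) (h : ∀ σ : K →+* ℂ, ‖σ y‖ ≤ C) :
    ‖((minpoly ℚ y).coeff 0 : ℂ)‖ ≤ C ^ (minpoly ℚ y).natDegree * ‖σ y‖ := by
  refine norm_coeff_zero_minpoly_le σ y (Algebra.IsIntegral.isIntegral y) C hC fun x hx => ?_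
  obtain ⟨σ, rfl⟩ := exists_ringHom_apply_eq_of_mem_aroots y x hx
  exact h σ

theorem hasLiouvilleBound_complex {K : Type*} [Field K] [CharZero K] [Algebra.IsAlgebraic ℚ K]
    (σ : K →+* ℂ) : HasLiouvilleBound ((NormedField.toAbsoluteValue ℂ).comp σ.injective) := by
  intro D C y hC hy hy0 hD hσ
  obtain ⟨b, hb0, hb⟩ := exists_int_eq_coeff_zero_minpoly y hy hy0
  have h := abs_coeff_zero_minpoly_le σ y C hC hσ
  rw [hb] at h
  have h1 : (1 : ℝ) ≤ ‖((b : ℚ) : ℂ)‖ := by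
    rw [Rat.cast_intCast, Complex.norm_intCast]
    exact_mod_cast Int.one_le_abs hb0
  refine h1.trans (h.trans ?_)
  exact mul_le_mul_of_nonneg_right (pow_le_pow_right₀ hC (by omega)) (norm_nonneg _)

theorem norm_le_one_of_isIntegral_int {L : Type*} [NormedField L] [IsUltrametricDist L] (x : L)
    (hx : IsIntegral ℤ x) : ‖x‖ ≤ 1 := by
  have h1 : IsIntegral (NormedField.valuation (K := L)).integer x := hx.tower_top
  exact (Valuation.integer.integers (NormedField.valuation (K := L))).mem_of_integral h1

theorem one_le_abs_mul_padicNorm (p : ℕ) [Fact p.Prime] (b : ℤ) (hb : b ≠ 0) :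
    1 ≤ |(b : ℝ)| * ‖(b : ℚ_[p])‖ := by
  have h := Int.natAbs_ne_zero.2 hb
  rw [Padic.norm_eq_zpow_neg_valuation (by exact_mod_cast hb), Padic.valuation_intCast, padicValInt,
    zpow_neg, ← div_eq_mul_inv, one_le_div (by have := (Fact.out : p.Prime).pos; positivity)]
  rw [zpow_natCast, ← Int.cast_abs, Int.abs_eq_natAbs]
  exact_mod_cast Nat.le_of_dvd (Nat.pos_of_ne_zero h) pow_padicValNat_dvd

theorem hasLiouvilleBound_padic {K : Type*} [Field K] [CharZero K] [Algebra.IsAlgebraic ℚ K] (p : ℕ)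
    [Fact p.Prime] (ι : K →+* PadicAlgCl p) :
    HasLiouvilleBound ((NormedField.toAbsoluteValue (PadicAlgCl p)).comp ι.injective) := by
  intro D C y hC hy hy0 hD hσ
  obtain ⟨b, hb0, hb⟩ := exists_int_eq_coeff_zero_minpoly y hy hy0
  have hyq : IsIntegral ℚ y := hy.tower_top
  let σ : K →+* ℂ := (IsAlgClosed.lift (R := ℚ) (M := ℂ) (S := K)).toRingHom
  have h1 := abs_coeff_zero_minpoly_le σ y C hC hσ
  have h1' : ‖((minpoly ℚ y).coeff 0 : ℂ)‖ ≤ C ^ (D + 1) := by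
    refine h1.trans ?_
    rw [pow_succ]
    exact mul_le_mul (pow_le_pow_right₀ hC hD) (hσ σ) (norm_nonneg _) (by positivity)
  have h2 : ‖((minpoly ℚ y).coeff 0 : PadicAlgCl p)‖ ≤ ‖ι y‖ := by
    have := norm_coeff_zero_minpoly_le ι y hyq 1 le_rfl fun x hx => by
      obtain ⟨ι', rfl⟩ := exists_ringHom_apply_eq_of_mem_aroots y x hx
      exact norm_le_one_of_isIntegral_int _ (hy.map ι'.toIntAlgHom)
    rwa [one_pow, one_mul] at this
  rw [hb] at h1' h2
  rw [Rat.cast_intCast, Complex.norm_intCast] at h1'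
  have h3 : ‖(((b : ℤ) : ℚ) : PadicAlgCl p)‖ = ‖(b : ℚ_[p])‖ := by
    rw [← PadicAlgCl.norm_extends]
    congr 1
  rw [h3] at h2
  refine (one_le_abs_mul_padicNorm p b hb0).trans ?_
  exact mul_le_mul h1' h2 (norm_nonneg _) (by positivity)

theorem coeff_norm_le_one_of_forall_root {L : Type*} [NormedField L] [IsUltrametricDist L]
    [IsAlgClosed L] (f : Polynomial L) (hf : f.Monic) (h : ∀ x ∈ f.roots, ‖x‖ ≤ 1) (i : ℕ) :
    ‖f.coeff i‖ ≤ 1 := by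
  let O := (NormedField.valuation (K := L)).integer
  have h1 : f ∈ Polynomial.lifts O.subtype := by
    rw [(IsAlgClosed.splits f).eq_prod_roots_of_monic hf]
    refine Submonoid.multiset_prod_mem (Polynomial.lifts O.subtype).toSubmonoid _ fun g hg => ?_
    obtain ⟨x, hx, rfl⟩ := Multiset.mem_map.1 hg
    refine (Polynomial.mem_lifts _).2 ⟨Polynomial.X - Polynomial.C ⟨x, h x hx⟩, by simp⟩
  obtain ⟨x, hx⟩ := (Polynomial.lifts_iff_coeff_lifts f).1 h1 i
  rw [← hx]
  exact x.2

theorem isIntegral_int_of_forall_padic {K : Type*} [Field K] [CharZero K]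
    [Algebra.IsAlgebraic ℚ K] (s : K)
    (h : ∀ (p : ℕ) [Fact p.Prime] (ι : K →+* PadicAlgCl p), ‖ι s‖ ≤ 1) : IsIntegral ℤ s := by
  have hm := minpoly.monic (Algebra.IsIntegral.isIntegral (R := ℚ) s)
  have hl : minpoly ℚ s ∈ Polynomial.lifts (algebraMap ℤ ℚ) := by
    rw [Polynomial.lifts_iff_coeff_lifts]
    intro i
    refine ⟨((minpoly ℚ s).coeff i).num, ?_⟩
    rw [eq_intCast, ← Rat.den_eq_one_iff]
    by_contra hden
    obtain ⟨p, hp, hpd⟩ := Nat.exists_prime_and_dvd hden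
    have : Fact p.Prime := ⟨hp⟩
    have h1 := coeff_norm_le_one_of_forall_root
      ((minpoly ℚ s).map (algebraMap ℚ (PadicAlgCl p))) (hm.map _) (fun x hx => by
        obtain ⟨ι, rfl⟩ := exists_ringHom_apply_eq_of_mem_aroots s x hx
        exact h p ι) i
    rw [Polynomial.coeff_map] at h1
    have h2 : ‖(((minpoly ℚ s).coeff i : ℚ) : ℚ_[p])‖ ≤ 1 := by
      rw [← PadicAlgCl.norm_extends]
      convert h1
      simp
    rw [Padic.norm_rat_le_one_iff_padicValuation_le_one, Rat.padicValuation_le_one_iff] at h2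
    exact h2 hpd
  obtain ⟨q, hq, -, hqm⟩ := Polynomial.lifts_and_natDegree_eq_and_monic hl hm
  refine ⟨q, hqm, ?_⟩
  have := minpoly.aeval ℚ s
  rw [← hq, Polynomial.aeval_map_algebraMap] at this
  exact this

theorem exists_hasLiouvilleBound_lt_one (k K : Type*) [Field k] [NumberField k] [Field K]
    [CharZero K]
    [Algebra k K] [Algebra.IsAlgebraic ℚ K] [Algebra.IsAlgebraic k K] (t : k) (ht : t ≠ 0)
    (h : ∀ n > 0, t ^ n ≠ 1) :
    ∃ v : AbsoluteValue K ℝ, HasLiouvilleBound v ∧ v (algebraMap k K t) < 1 := by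
  by_contra! hcon
  have hinj := (algebraMap k K).injective
  have hs0 : algebraMap k K t ≠ 0 := by rwa [Ne, map_eq_zero]
  have hinv (v : AbsoluteValue K ℝ) (hv : HasLiouvilleBound v) :
      v (algebraMap k K t⁻¹) ≤ 1 := by
    rw [map_inv₀, map_inv₀]
    exact inv_le_one_of_one_le₀ (hcon v hv)
  have h_int : IsIntegral ℤ (algebraMap k K t⁻¹) :=
    isIntegral_int_of_forall_padic _ fun p _ ι => hinv _ (hasLiouvilleBound_padic p ι)
  have h_int' : IsIntegral ℤ t⁻¹ := (isIntegral_algebraMap_iff hinj).1 h_int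
  obtain ⟨n, hn, hn1⟩ := NumberField.Embeddings.pow_eq_one_of_norm_le_one k ℂ
    (inv_ne_zero ht) h_int' fun φ => by
      let := φ.toAlgebra
      let σ : K →ₐ[k] ℂ := IsAlgClosed.lift (R := k) (M := ℂ) (S := K)
      have h1 := hinv _ (hasLiouvilleBound_complex σ.toRingHom)
      have h2 : σ (algebraMap k K t⁻¹) = φ t⁻¹ := σ.commutes _
      rw [← h2]
      exact h1
  apply h n hn
  rwa [inv_pow, inv_eq_one] at hn1

/-- The sequence `y` has denominators and conjugates growing at most like `Q * M ^ n`. -/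
def ExpBdd {K : Type*} [Field K] (Q M : ℕ) (y : ℕ → K) : Prop :=
  ∀ n, IsIntegral ℤ (((Q * M ^ n : ℕ) : K) * y n) ∧
    ∀ σ : K →+* ℂ, ‖σ (y n)‖ ≤ ((Q * M ^ n : ℕ) : ℝ)

namespace ExpBdd

variable {K : Type*} [Field K]

theorem isIntegral_natCast (n : ℕ) : IsIntegral ℤ (n : K) := by
  have := isIntegral_algebraMap (R := ℤ) (A := K) (x := (n : ℤ))
  simpa using this

theorem isIntegral_of_eq {x y : K} (hx : IsIntegral ℤ x) (h : y = x) : IsIntegral ℤ y :=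
  h ▸ hx

theorem mono {Q M Q' M' : ℕ} {y : ℕ → K} (h : ExpBdd Q M y) (hQ : Q ∣ Q') (hQ' : Q' ≠ 0)
    (hM : M ∣ M') (hM' : M' ≠ 0) : ExpBdd Q' M' y := by
  intro n
  obtain ⟨h1, h2⟩ := h n
  have hd : Q * M ^ n ∣ Q' * M' ^ n := mul_dvd_mul hQ (pow_dvd_pow_of_dvd hM n)
  refine ⟨?_, fun σ => (h2 σ).trans ?_⟩
  · obtain ⟨c, hc⟩ := hd
    rw [hc, Nat.cast_mul, mul_comm _ (c : K), mul_assoc]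
    exact (isIntegral_natCast c).mul h1
  · exact_mod_cast Nat.le_of_dvd (Nat.pos_of_ne_zero (mul_ne_zero hQ' (pow_ne_zero _ hM'))) hd

theorem add {Q M Q' : ℕ} {y z : ℕ → K} (hQ : Q ≠ 0) (hQ' : Q' ≠ 0) (h : ExpBdd Q M y)
    (h' : ExpBdd Q' M z) : ExpBdd (2 * Q * Q') M (fun n => y n + z n) := by
  intro n
  obtain ⟨h1, h2⟩ := h n
  obtain ⟨h1', h2'⟩ := h' n
  refine ⟨?_, fun σ => ?_⟩
  · have := ((isIntegral_natCast (2 * Q')).mul h1).add ((isIntegral_natCast (2 * Q)).mul h1')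
    refine isIntegral_of_eq (this) ?_
    push_cast
    ring
  · rw [map_add]
    refine (norm_add_le _ _).trans ((add_le_add (h2 σ) (h2' σ)).trans ?_)
    rw [← Nat.cast_add, Nat.cast_le, ← add_mul]
    refine Nat.mul_le_mul_right _ ?_
    have h3 := Nat.pos_of_ne_zero hQ
    have h4 := Nat.pos_of_ne_zero hQ'
    nlinarith

theorem mul {Q M Q' M' : ℕ} {y z : ℕ → K} (h : ExpBdd Q M y)
    (h' : ExpBdd Q' M' z) : ExpBdd (Q * Q') (M * M') (fun n => y n * z n) := by
  intro n
  obtain ⟨h1, h2⟩ := h n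
  obtain ⟨h1', h2'⟩ := h' n
  refine ⟨?_, fun σ => ?_⟩
  · refine isIntegral_of_eq (h1.mul h1') ?_
    push_cast
    ring
  · rw [map_mul, norm_mul]
    refine (mul_le_mul (h2 σ) (h2' σ) (norm_nonneg _) (Nat.cast_nonneg _)).trans ?_
    rw [← Nat.cast_mul, Nat.cast_le, mul_pow]
    exact le_of_eq (by ring)

theorem zero (Q M : ℕ) : ExpBdd Q M (fun _ => (0 : K)) := fun n =>
  ⟨by rw [mul_zero]; exact isIntegral_zero, fun σ => by rw [map_zero, norm_zero]; positivity⟩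

theorem exists_mul_isIntegral [CharZero K] [Algebra.IsAlgebraic ℚ K] (s : K) :
    ∃ N : ℕ, N ≠ 0 ∧ IsIntegral ℤ ((N : K) * s) ∧ ∀ σ : K →+* ℂ, ‖σ s‖ ≤ N := by
  obtain ⟨q, hq0, hq⟩ : ∃ q : ℕ, q ≠ 0 ∧ IsIntegral ℤ ((q : K) * s) := by
    have h1 : IsAlgebraic ℤ s :=
      (IsFractionRing.isAlgebraic_iff ℤ ℚ K).2 (Algebra.IsAlgebraic.isAlgebraic s)
    obtain ⟨y, hy0, hy⟩ := h1.exists_integral_multiple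
    refine ⟨y.natAbs, Int.natAbs_ne_zero.2 hy0, ?_⟩
    rw [Algebra.smul_def] at hy
    rcases Int.natAbs_eq y with h2 | h2
    · rw [h2] at hy
      simpa using hy
    · rw [h2] at hy
      simpa using hy.neg
  obtain ⟨C, hC⟩ : ∃ C : ℝ, ∀ σ : K →+* ℂ, ‖σ s‖ ≤ C := by
    have hfin : ((fun x : ℂ => ‖x‖) '' ((minpoly ℚ s).rootSet ℂ)).Finite :=
      (Polynomial.rootSet_finite _ _).image _
    obtain ⟨C, hC⟩ := hfin.bddAbove
    refine ⟨C, fun σ => hC ⟨σ s, ?_, rfl⟩⟩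
    rw [← Algebra.IsAlgebraic.range_eval_eq_rootSet_minpoly]
    exact ⟨σ.toRatAlgHom, rfl⟩
  obtain ⟨m, hm⟩ := exists_nat_ge C
  refine ⟨q * (m + 1), by positivity, ?_, fun σ => (hC σ).trans (hm.trans ?_)⟩
  · refine isIntegral_of_eq ((isIntegral_natCast (m + 1)).mul hq) ?_
    push_cast
    ring
  · have : m ≤ q * (m + 1) := by
      have := Nat.pos_of_ne_zero hq0
      nlinarith
    exact_mod_cast this

theorem exists_const [CharZero K] [Algebra.IsAlgebraic ℚ K] (s : K) :
    ∃ Q : ℕ, Q ≠ 0 ∧ ExpBdd Q 1 (fun _ => s) := by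
  obtain ⟨N, h0, h1, h2⟩ := exists_mul_isIntegral s
  exact ⟨N, h0, fun n => by simpa using ⟨h1, h2⟩⟩

theorem exists_pow [CharZero K] [Algebra.IsAlgebraic ℚ K] (s : K) :
    ∃ M : ℕ, M ≠ 0 ∧ ExpBdd 1 M (fun n => s ^ n) := by
  obtain ⟨N, h0, h1, h2⟩ := exists_mul_isIntegral s
  refine ⟨N, h0, fun n => ⟨?_, fun σ => ?_⟩⟩
  · rw [one_mul, Nat.cast_pow, ← mul_pow]
    exact h1.pow n
  · rw [one_mul, Nat.cast_pow, map_pow, norm_pow]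
    exact pow_le_pow_left₀ (norm_nonneg _) (h2 σ) n

theorem shift {Q M : ℕ} {y : ℕ → K} (h : ExpBdd Q M y) (s : ℕ) :
    ExpBdd (Q * M ^ s) M (fun n => y (n + s)) := by
  intro n
  have := h (n + s)
  rwa [pow_add, mul_comm (M ^ n), ← mul_assoc] at this

theorem exists_const_mul [CharZero K] [Algebra.IsAlgebraic ℚ K] {Q M : ℕ} {y : ℕ → K} (hQ : Q ≠ 0)
    (h : ExpBdd Q M y) (s : K) : ∃ Q' : ℕ, Q' ≠ 0 ∧ ExpBdd Q' M (fun n => s * y n) := by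
  obtain ⟨Q', h0, h1⟩ := exists_const s
  refine ⟨Q' * Q, mul_ne_zero h0 hQ, ?_⟩
  have := h1.mul h
  rwa [one_mul] at this

theorem exists_sum {ι : Type*} (s : Finset ι) (M : ℕ) (y : ι → ℕ → K)
    (h : ∀ i ∈ s, ∃ Q : ℕ, Q ≠ 0 ∧ ExpBdd Q M (y i)) :
    ∃ Q : ℕ, Q ≠ 0 ∧ ExpBdd Q M (fun n => ∑ i ∈ s, y i n) := by
  classical
  induction s using Finset.induction_on with
  | empty => exact ⟨1, one_ne_zero, by simpa using zero 1 M⟩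
  | insert a s ha ih =>
    obtain ⟨Q, hQ, h1⟩ := ih fun i hi => h i (Finset.mem_insert_of_mem hi)
    obtain ⟨Q', hQ', h2⟩ := h a (Finset.mem_insert_self _ _)
    refine ⟨2 * Q' * Q, by positivity, ?_⟩
    simp only [Finset.sum_insert ha]
    exact h2.add hQ' hQ h1

/-- Evaluation of a polynomial along a sequence with exponentially bounded growth. -/
theorem exists_eval [CharZero K] [Algebra.IsAlgebraic ℚ K] {Q M : ℕ} {y : ℕ → K} (hQ : Q ≠ 0)
    (hM : M ≠ 0) (h : ExpBdd Q M y) (p : Polynomial K) :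
    ∃ Q' M' : ℕ, Q' ≠ 0 ∧ M' ≠ 0 ∧ ExpBdd Q' M' (fun n => p.eval (y n)) := by
  induction p using Polynomial.induction_on' with
  | add p q hp hq =>
    obtain ⟨Q1, M1, hQ1, hM1, h1⟩ := hp
    obtain ⟨Q2, M2, hQ2, hM2, h2⟩ := hq
    refine ⟨2 * Q1 * Q2, M1 * M2, by positivity, by positivity, ?_⟩
    simp only [Polynomial.eval_add]
    exact (h1.mono dvd_rfl hQ1 (dvd_mul_right _ _) (by positivity)).add hQ1 hQ2
      (h2.mono dvd_rfl hQ2 (dvd_mul_left _ _) (by positivity))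
  | monomial m c =>
    obtain ⟨Q1, hQ1, h1⟩ := exists_const c
    have h2 : ExpBdd (Q ^ m) (M ^ m) (fun n => y n ^ m) := by
      induction m with
      | zero => exact fun n => ⟨by simpa using isIntegral_one, fun σ => by simp⟩
      | succ m ih =>
        simp only [pow_succ]
        exact ih.mul h
    refine ⟨Q1 * Q ^ m, 1 * M ^ m, by positivity, by positivity, ?_⟩
    simp only [Polynomial.eval_monomial]
    exact h1.mul h2

theorem _root_.AbsoluteValue.le_of_pow_add_sum_eq_zero {L : Type*} [Field L]
    (v : AbsoluteValue L ℝ) (r : ℕ) (c : ℕ → L) (z : L) (S : ℝ)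
    (hS : ∀ i < r, v (c i) ≤ S) (hz : z ^ r + ∑ i ∈ Finset.range r, c i * z ^ i = 0) :
    v z ≤ max 1 (r * S) := by
  by_contra! hcon
  obtain ⟨h1, h2⟩ := max_lt_iff.1 hcon
  rcases r with _ | r
  · simp at hz
  have h3 : v (z ^ (r + 1)) ≤ (r + 1 : ℕ) * S * v z ^ r := by
    rw [eq_neg_of_add_eq_zero_left hz, v.map_neg]
    refine (v.sum_le _ _).trans ?_
    have : ((r + 1 : ℕ) : ℝ) * S * v z ^ r = ∑ i ∈ Finset.range (r + 1), S * v z ^ r := by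
      rw [Finset.sum_const, Finset.card_range, nsmul_eq_mul, mul_assoc]
    rw [this]
    refine Finset.sum_le_sum fun i hi => ?_
    rw [map_mul, map_pow]
    have hi' := Finset.mem_range.1 hi
    exact mul_le_mul (hS i hi') (pow_le_pow_right₀ h1.le (by omega)) (by positivity)
      ((v.nonneg _).trans (hS i hi'))
  rw [map_pow, pow_succ'] at h3
  have h4 : 0 < v z ^ r := by positivity
  exact absurd (le_of_mul_le_mul_right h3 h4) (not_le.2 h2)

theorem isIntegral_mul_of_pow_add_sum_eq_zero (r : ℕ) (c : ℕ → K) (z q : K) (hq : IsIntegral ℤ q)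
    (hc : ∀ i < r, IsIntegral ℤ (q * c i))
    (hz : z ^ r + ∑ i ∈ Finset.range r, c i * z ^ i = 0) : IsIntegral ℤ (q * z) := by
  let A := integralClosure ℤ K
  let b : ℕ → A := fun i => if h : i < r then ⟨q ^ (r - 1 - i) * (q * c i), (hq.pow _).mul (hc i h)⟩
    else 0
  have h1 : IsIntegral A (q * z) := by
    refine ⟨Polynomial.X ^ r + ∑ i ∈ Finset.range r, Polynomial.C (b i) * Polynomial.X ^ i, ?_, ?_⟩
    · refine Polynomial.monic_X_pow_add ?_
      refine (Polynomial.degree_sum_le _ _).trans_lt ?_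
      rw [Finset.sup_lt_iff (WithBot.bot_lt_coe _)]
      intro i hi
      exact (Polynomial.degree_C_mul_X_pow_le _ _).trans_lt
        (by exact_mod_cast Finset.mem_range.1 hi)
    · rw [Polynomial.eval₂_add, Polynomial.eval₂_X_pow, Polynomial.eval₂_finsetSum]
      have h2 : ∑ i ∈ Finset.range r, Polynomial.eval₂ (algebraMap A K) (q * z)
          (Polynomial.C (b i) * Polynomial.X ^ i) =
          q ^ r * ∑ i ∈ Finset.range r, c i * z ^ i := by
        rw [Finset.mul_sum]
        refine Finset.sum_congr rfl fun i hi => ?_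
        have hi' := Finset.mem_range.1 hi
        rw [Polynomial.eval₂_mul, Polynomial.eval₂_C, Polynomial.eval₂_X_pow]
        have hb : algebraMap A K (b i) = q ^ (r - 1 - i) * (q * c i) := by
          simp only [b, dif_pos hi']
          rfl
        have hr : q ^ r = q ^ (r - 1 - i) * q * q ^ i := by
          rw [← pow_succ, ← pow_add]
          congr 1
          omega
        rw [hb, hr, mul_pow]
        ring
      rw [h2, mul_pow, ← mul_add, hz, mul_zero]
  exact isIntegral_trans _ h1

theorem exists_of_root {r : ℕ} (c : ℕ → ℕ → K) (z : ℕ → K)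
    (hc : ∀ i, ∃ Q M : ℕ, Q ≠ 0 ∧ M ≠ 0 ∧ ExpBdd Q M (c i))
    (hz : ∀ n, z n ^ r + ∑ i ∈ Finset.range r, c i n * z n ^ i = 0) :
    ∃ Q M : ℕ, Q ≠ 0 ∧ M ≠ 0 ∧ ExpBdd Q M z := by
  choose Q M hQ hM h using hc
  have hQ0 : ∏ i ∈ Finset.range r, Q i ≠ 0 := Finset.prod_ne_zero_iff.2 fun i _ => hQ i
  have hM0 : ∏ i ∈ Finset.range r, M i ≠ 0 := Finset.prod_ne_zero_iff.2 fun i _ => hM i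
  have h' : ∀ i < r, ExpBdd (∏ i ∈ Finset.range r, Q i) (∏ i ∈ Finset.range r, M i) (c i) :=
    fun i hi => (h i).mono (Finset.dvd_prod_of_mem _ (Finset.mem_range.2 hi)) hQ0
      (Finset.dvd_prod_of_mem _ (Finset.mem_range.2 hi)) hM0
  generalize ∏ i ∈ Finset.range r, Q i = Q' at *
  generalize ∏ i ∈ Finset.range r, M i = M' at *
  refine ⟨(r + 1) * Q', M', by positivity, hM0, fun n => ⟨?_, fun σ => ?_⟩⟩
  · have := isIntegral_mul_of_pow_add_sum_eq_zero r (fun i => c i n) (z n) _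
      (isIntegral_natCast _) (fun i hi => (h' i hi n).1) (hz n)
    refine isIntegral_of_eq ((isIntegral_natCast (r + 1)).mul this) ?_
    push_cast
    ring
  · have := ((NormedField.toAbsoluteValue ℂ).comp σ.injective).le_of_pow_add_sum_eq_zero r
      (fun i => c i n) (z n) _ (fun i hi => (h' i hi n).2 σ) (hz n)
    refine this.trans (max_le ?_ ?_)
    · exact_mod_cast Nat.one_le_iff_ne_zero.2 (by positivity)
    · have : r * (Q' * M' ^ n) ≤ (r + 1) * Q' * M' ^ n := by
        rw [mul_assoc]
        exact Nat.mul_le_mul_right _ (Nat.le_succ r)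
      exact_mod_cast this

end ExpBdd

theorem HasLiouvilleBound.exists_le {k K : Type*} [Field k] [NumberField k] [Field K] [CharZero K]
    [Algebra k K] (v : AbsoluteValue K ℝ) (hv : HasLiouvilleBound v) (M : ℕ) (hM : M ≠ 0) :
    ∃ θ : ℝ, 0 < θ ∧ ∀ (Q : ℕ) (y : ℕ → k), Q ≠ 0 → ExpBdd Q M (fun n => algebraMap k K (y n)) →
      ∃ c : ℝ, 0 < c ∧ ∀ n, y n ≠ 0 → c * θ ^ n ≤ v (algebraMap k K (y n)) := by
  set D := Module.finrank ℚ k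
  have hvn (n : ℕ) : v (n : K) ≤ n := by
    induction n with
    | zero => simp
    | succ n ih =>
      push_cast
      refine (v.add_le _ _).trans ?_
      rw [v.map_one]
      linarith
  have key (Q : ℕ) (y : ℕ → k) (hQ : Q ≠ 0) (hy : ExpBdd Q M (fun n => algebraMap k K (y n)))
      (n : ℕ) (hn : y n ≠ 0) : 1 ≤ ((Q * M ^ n : ℕ) : ℝ) ^ (2 * (D + 1) + 1) *
        v (algebraMap k K (y n)) := by
    obtain ⟨h1, h2⟩ := hy n
    have hN : Q * M ^ n ≠ 0 := mul_ne_zero hQ (pow_ne_zero _ hM)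
    generalize Q * M ^ n = N at *
    have hN1 : (1 : ℝ) ≤ N := by exact_mod_cast Nat.one_le_iff_ne_zero.2 hN
    have h3 := hv D ((N : ℝ) ^ 2) _ (one_le_pow₀ hN1) h1
      (mul_ne_zero (by exact_mod_cast hN) (by rwa [Ne, map_eq_zero])) (by
        have : (N : K) * algebraMap k K (y n) = algebraMap k K (N * y n) := by simp
        rw [this, minpoly.algebraMap_eq (algebraMap k K).injective]
        exact minpoly.natDegree_le _) (fun σ => by
        rw [map_mul, norm_mul, pow_two]
        refine mul_le_mul ?_ (h2 σ) (norm_nonneg _) (by positivity)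
        simp)
    refine h3.trans ?_
    rw [map_mul, ← pow_mul, pow_succ _ (2 * (D + 1)), mul_assoc]
    refine mul_le_mul_of_nonneg_left ?_ (by positivity)
    exact mul_le_mul_of_nonneg_right (hvn N) (v.nonneg _)
  have hMpos : (0 : ℝ) < M := by exact_mod_cast Nat.pos_of_ne_zero hM
  refine ⟨(((M : ℝ) ^ (2 * (D + 1) + 1)))⁻¹, by positivity, fun Q y hQ hy => ?_⟩
  have hQpos : (0 : ℝ) < Q := by exact_mod_cast Nat.pos_of_ne_zero hQ
  refine ⟨((Q : ℝ) ^ (2 * (D + 1) + 1))⁻¹, by positivity, fun n hn => ?_⟩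
  have h1 := key Q y hQ hy n hn
  rw [← inv_pow, ← inv_pow, ← pow_mul, mul_comm _ n, pow_mul, ← mul_pow, inv_pow, ← mul_inv,
    inv_pow, inv_le_iff_one_le_mul₀' (by positivity)]
  push_cast at h1
  exact h1

theorem AbsoluteValue.exists_eval_le {K : Type*} [Field K] (v : AbsoluteValue K ℝ)
    (p : Polynomial K) (U : ℝ) : ∃ C, 0 ≤ C ∧ ∀ u, v u ≤ U → v (p.eval u) ≤ C := by
  refine ⟨∑ i ∈ Finset.range (p.natDegree + 1), v (p.coeff i) * |U| ^ i,
    Finset.sum_nonneg fun i _ => by positivity, fun u hu => ?_⟩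
  rw [Polynomial.eval_eq_sum_range]
  refine (v.sum_le _ _).trans (Finset.sum_le_sum fun i _ => ?_)
  rw [map_mul, map_pow]
  exact mul_le_mul_of_nonneg_left (pow_le_pow_left₀ (v.nonneg _) (hu.trans (le_abs_self _)) _)
    (v.nonneg _)

theorem AbsoluteValue.exists_eval_le_of_X_pow_dvd {K : Type*} [Field K] (v : AbsoluteValue K ℝ)
    (J : ℕ) (p : Polynomial K) (hp : Polynomial.X ^ J ∣ p) (U : ℝ) :
    ∃ C, 0 ≤ C ∧ ∀ u, v u ≤ U → v (p.eval u) ≤ C * v u ^ J := by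
  obtain ⟨q, rfl⟩ := hp
  obtain ⟨C, hC, h⟩ := v.exists_eval_le q U
  refine ⟨C, hC, fun u hu => ?_⟩
  rw [Polynomial.eval_mul, Polynomial.eval_pow, Polynomial.eval_X, map_mul, map_pow, mul_comm]
  exact mul_le_mul_of_nonneg_right (h u hu) (by positivity)

theorem AbsoluteValue.exists_eval₂_le {K : Type*} [Field K] (v : AbsoluteValue K ℝ)
    (G : Polynomial (Polynomial K)) (U S : ℝ) :
    ∃ C, 0 ≤ C ∧ ∀ u z, v u ≤ U → v z ≤ S → v (G.eval₂ (Polynomial.evalRingHom u) z) ≤ C := by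
  choose c hc0 hc using fun i => v.exists_eval_le (G.coeff i) U
  refine ⟨∑ i ∈ Finset.range (G.natDegree + 1), c i * |S| ^ i,
    Finset.sum_nonneg fun i _ => mul_nonneg (hc0 i) (by positivity), fun u z hu hz => ?_⟩
  rw [Polynomial.eval₂_eq_sum_range]
  refine (v.sum_le _ _).trans (Finset.sum_le_sum fun i _ => ?_)
  rw [map_mul, map_pow]
  exact mul_le_mul (hc i u hu) (pow_le_pow_left₀ (v.nonneg _) (hz.trans (le_abs_self _)) _)
    (by positivity) (hc0 i)

theorem dvd_prod_sub_prod {R ι : Type*} [CommRing R] (s : Finset ι) (x y : ι → R) (a : R)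
    (h : ∀ i, a ∣ x i - y i) : a ∣ ∏ i ∈ s, x i - ∏ i ∈ s, y i := by
  classical
  induction s using Finset.induction_on with
  | empty => simp
  | insert i s hi ih =>
    rw [Finset.prod_insert hi, Finset.prod_insert hi]
    have : x i * ∏ i ∈ s, x i - y i * ∏ i ∈ s, y i =
        (x i - y i) * ∏ i ∈ s, x i + y i * (∏ i ∈ s, x i - ∏ i ∈ s, y i) := by ring
    rw [this]
    exact dvd_add ((h i).mul_right _) (ih.mul_left _)

theorem PowerSeries.X_pow_dvd_trunc_sub {K : Type*} [Field K] (N : ℕ) (φ : PowerSeries K) :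
    PowerSeries.X ^ N ∣ (PowerSeries.trunc N φ : PowerSeries K) - φ := by
  rw [PowerSeries.X_pow_dvd_iff]
  intro m hm
  rw [map_sub, Polynomial.coeff_coe, PowerSeries.coeff_trunc, if_pos hm, sub_self]

theorem Polynomial.X_pow_dvd_of_coe {K : Type*} [Field K] (N : ℕ) (p : Polynomial K)
    (h : PowerSeries.X ^ N ∣ (p : PowerSeries K)) : Polynomial.X ^ N ∣ p := by
  rw [PowerSeries.X_pow_dvd_iff] at h
  rw [Polynomial.X_pow_dvd_iff]
  intro m hm
  rw [← Polynomial.coeff_coe]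
  exact h m hm

theorem AbsoluteValue.exists_root_approx {K : Type*} [Field K] (v : AbsoluteValue K ℝ) {r : ℕ}
    (hr : r ≠ 0) (f : Polynomial (Polynomial K)) (hf : f.Monic) (φ : Fin r → PowerSeries K)
    (h : f.map Polynomial.coeToPowerSeries.ringHom =
      ∏ i, (Polynomial.X - Polynomial.C (φ i))) (J : ℕ) (U : ℝ) :
    ∃ C, 0 ≤ C ∧ ∀ u z, u ≠ 0 → v u ≤ U → f.eval₂ (Polynomial.evalRingHom u) z = 0 →
      v z ≤ C ∧ ∃ i, v (z - (PowerSeries.trunc J (φ i)).eval u) ≤ C * v u ^ J := by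
  obtain ⟨S, hS⟩ : ∃ S, ∀ u z, v u ≤ U → f.eval₂ (Polynomial.evalRingHom u) z = 0 → v z ≤ S := by
    choose c hc0 hc using fun i => v.exists_eval_le (f.coeff i) U
    refine ⟨max 1 (f.natDegree * ∑ i ∈ Finset.range f.natDegree, c i), fun u z hu hz => ?_⟩
    refine v.le_of_pow_add_sum_eq_zero f.natDegree (fun i => (f.coeff i).eval u) z _
      (fun i hi => (hc i u hu).trans (Finset.single_le_sum (fun i _ => hc0 i)
        (Finset.mem_range.2 hi))) ?_
    conv at hz => rw [hf.as_sum]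
    rw [Polynomial.eval₂_add, Polynomial.eval₂_X_pow, Polynomial.eval₂_finsetSum] at hz
    simpa only [Polynomial.eval₂_mul, Polynomial.eval₂_C, Polynomial.eval₂_X_pow,
      Polynomial.coe_evalRingHom] using hz
  let p : Fin r → Polynomial K := fun i => PowerSeries.trunc (r * J) (φ i)
  obtain ⟨G, hG⟩ : Polynomial.C (Polynomial.X ^ (r * J)) ∣
      ∏ i, (Polynomial.X - Polynomial.C (p i)) - f := by
    rw [Polynomial.C_dvd_iff_dvd_coeff]
    intro m
    apply Polynomial.X_pow_dvd_of_coe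
    have h1 : Polynomial.C (PowerSeries.X ^ (r * J) : PowerSeries K) ∣
        ∏ i, (Polynomial.X - Polynomial.C (p i : PowerSeries K)) -
          ∏ i, (Polynomial.X - Polynomial.C (φ i)) := by
      refine dvd_prod_sub_prod _ _ _ _ fun i => ?_
      rw [sub_sub_sub_cancel_left, ← Polynomial.C_sub]
      refine map_dvd Polynomial.C ?_
      rw [← dvd_neg, neg_sub]
      exact PowerSeries.X_pow_dvd_trunc_sub _ _
    have h2 := (Polynomial.C_dvd_iff_dvd_coeff _ _).1 h1 m
    rw [← h] at h2
    convert h2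
    rw [← Polynomial.coeToPowerSeries.ringHom_apply, ← Polynomial.coeff_map, Polynomial.map_sub,
      Polynomial.map_prod]
    simp
  obtain ⟨C₁, hC₁, hb⟩ := v.exists_eval₂_le G U S
  choose c hc0 hc using fun i => v.exists_eval_le_of_X_pow_dvd J
    (p i - PowerSeries.trunc J (φ i)) (by
      apply Polynomial.X_pow_dvd_of_coe
      have h1 := (pow_dvd_pow _ (Nat.le_mul_of_pos_left J (Nat.pos_of_ne_zero hr))).trans
        (PowerSeries.X_pow_dvd_trunc_sub (r * J) (φ i))
      have h2 := dvd_sub h1 (PowerSeries.X_pow_dvd_trunc_sub J (φ i))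
      rw [sub_sub_sub_cancel_right] at h2
      simpa using h2) U
  have hsum : 0 ≤ ∑ i, c i := Finset.sum_nonneg fun i _ => hc0 i
  refine ⟨max S ((1 + C₁) + ∑ i, c i), le_max_of_le_right (by positivity),
    fun u z hu0 hu hz => ⟨(hS u z hu hz).trans (le_max_left _ _), ?_⟩⟩
  have hv : 0 < v u := v.pos hu0
  obtain ⟨i, hi⟩ : ∃ i, v (z - (p i).eval u) ≤ (1 + C₁) * v u ^ J := by
    by_contra! hcon
    have h1 := congrArg (Polynomial.eval₂ (Polynomial.evalRingHom u) z) hG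
    rw [Polynomial.eval₂_sub, hz, sub_zero, Polynomial.eval₂_finsetProd, Polynomial.eval₂_mul,
      Polynomial.eval₂_C] at h1
    simp only [Polynomial.eval₂_sub, Polynomial.eval₂_X, Polynomial.eval₂_C,
      Polynomial.coe_evalRingHom, Polynomial.eval_pow, Polynomial.eval_X] at h1
    have h2 := congrArg v h1
    rw [map_prod, map_mul, map_pow] at h2
    have : Nonempty (Fin r) := ⟨⟨0, Nat.pos_of_ne_zero hr⟩⟩
    have h3 : ∏ _i : Fin r, ((1 + C₁) * v u ^ J) < ∏ i, v (z - (p i).eval u) :=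
      Finset.prod_lt_prod_of_nonempty (fun i _ => by positivity) (fun i _ => hcon i)
        Finset.univ_nonempty
    rw [Finset.prod_const, Finset.card_univ, Fintype.card_fin, h2, mul_pow, ← pow_mul,
      mul_comm J r, mul_comm] at h3
    have h4 := lt_of_mul_lt_mul_left h3 (by positivity)
    have h5 := hb u z hu (hS u z hu hz)
    have h6 : 1 + C₁ ≤ (1 + C₁) ^ r := le_self_pow₀ (by linarith) hr
    linarith
  refine ⟨i, ?_⟩
  have h1 := hc i u hu
  rw [Polynomial.eval_sub] at h1
  have h2 : z - (PowerSeries.trunc J (φ i)).eval u = (z - (p i).eval u) +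
      ((p i).eval u - (PowerSeries.trunc J (φ i)).eval u) := by ring
  rw [h2]
  refine (v.add_le _ _).trans ((add_le_add hi h1).trans ?_)
  rw [← add_mul]
  refine mul_le_mul_of_nonneg_right (le_max_of_le_right ?_) (by positivity)
  have := Finset.single_le_sum (fun i _ => hc0 i) (Finset.mem_univ i)
  linarith

theorem AbsoluteValue.exists_pair_approx {K : Type*} [Field K] (v : AbsoluteValue K ℝ) {r : ℕ}
    (hr : r ≠ 0) (f : Polynomial (Polynomial K)) (hf : f.Monic) (φ : Fin r → PowerSeries K)
    (h : f.map Polynomial.coeToPowerSeries.ringHom =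
      ∏ i, (Polynomial.X - Polynomial.C (φ i))) (J : ℕ) (U : ℝ) :
    ∃ C, 0 ≤ C ∧ ∀ u α β, u ≠ 0 → v u ≤ U → f.eval₂ (Polynomial.evalRingHom u) α = 0 →
      f.eval₂ (Polynomial.evalRingHom u) β = 0 → ∃ i : Fin r × Fin r,
        v (α + β - (PowerSeries.trunc J (φ i.1 + φ i.2)).eval u) ≤ C * v u ^ J ∧
        v (α * β - (PowerSeries.trunc J (φ i.1 * φ i.2)).eval u) ≤ C * v u ^ J := by
  obtain ⟨C, hC, hap⟩ := v.exists_root_approx hr f hf φ h J U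
  choose c hc0 hc using fun i : Fin r × Fin r => v.exists_eval_le_of_X_pow_dvd J
    (PowerSeries.trunc J (φ i.1) * PowerSeries.trunc J (φ i.2) -
      PowerSeries.trunc J (φ i.1 * φ i.2)) (by
      apply Polynomial.X_pow_dvd_of_coe
      have h1 := PowerSeries.X_pow_dvd_trunc_sub J (φ i.1)
      have h2 := PowerSeries.X_pow_dvd_trunc_sub J (φ i.2)
      have h3 := PowerSeries.X_pow_dvd_trunc_sub J (φ i.1 * φ i.2)
      have h4 := dvd_sub (dvd_add (h1.mul_right (PowerSeries.trunc J (φ i.2) : PowerSeries K))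
        (h2.mul_left (φ i.1))) h3
      convert h4 using 1
      push_cast
      ring) U
  choose d hd0 hd using fun i : Fin r => v.exists_eval_le (PowerSeries.trunc J (φ i)) U
  have hsum : 0 ≤ ∑ i, c i := Finset.sum_nonneg fun i _ => hc0 i
  have hsumd : 0 ≤ ∑ i, d i := Finset.sum_nonneg fun i _ => hd0 i
  refine ⟨2 * C + C * C + (∑ i, d i) * C + ∑ i, c i, by positivity,
    fun u α β hu0 hu hα hβ => ?_⟩
  obtain ⟨-, i, hi⟩ := hap u α hu0 hu hα
  obtain ⟨hβC, j, hj⟩ := hap u β hu0 hu hβ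
  have hv : 0 ≤ v u ^ J := by positivity
  refine ⟨(i, j), ?_, ?_⟩
  · have h1 : α + β - (PowerSeries.trunc J (φ i + φ j)).eval u =
        (α - (PowerSeries.trunc J (φ i)).eval u) + (β - (PowerSeries.trunc J (φ j)).eval u) := by
      rw [map_add, Polynomial.eval_add]
      ring
    rw [h1]
    refine (v.add_le _ _).trans ((add_le_add hi hj).trans ?_)
    rw [← add_mul]
    refine mul_le_mul_of_nonneg_right ?_ hv
    nlinarith [mul_nonneg hC hC, mul_nonneg hsumd hC]
  · have h1 : α * β - (PowerSeries.trunc J (φ i * φ j)).eval u =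
        (α - (PowerSeries.trunc J (φ i)).eval u) * β +
        (PowerSeries.trunc J (φ i)).eval u * (β - (PowerSeries.trunc J (φ j)).eval u) +
        (PowerSeries.trunc J (φ i) * PowerSeries.trunc J (φ j) -
          PowerSeries.trunc J (φ i * φ j)).eval u := by
      rw [Polynomial.eval_sub, Polynomial.eval_mul]
      ring
    rw [h1]
    refine (v.add_le _ _).trans ((add_le_add (v.add_le _ _) (hc (i, j) u hu)).trans ?_)
    rw [map_mul, map_mul]
    have h2 : v (α - (PowerSeries.trunc J (φ i)).eval u) * v β ≤ C * v u ^ J * C :=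
      mul_le_mul hi hβC (v.nonneg _) (by positivity)
    have h3 : v ((PowerSeries.trunc J (φ i)).eval u) *
        v (β - (PowerSeries.trunc J (φ j)).eval u) ≤ (∑ i, d i) * (C * v u ^ J) :=
      mul_le_mul ((hd i u hu).trans (Finset.single_le_sum (fun i _ => hd0 i) (Finset.mem_univ i)))
        hj (v.nonneg _) hsumd
    have h4 : c (i, j) * v u ^ J ≤ (∑ i, c i) * v u ^ J :=
      mul_le_mul_of_nonneg_right (Finset.single_le_sum (fun i _ => hc0 i) (Finset.mem_univ (i, j)))
        hv
    nlinarith [mul_nonneg hC hv]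

theorem AbsoluteValue.coeff_eq_zero_of_eval_le {K : Type*} [Field K] (v : AbsoluteValue K ℝ)
    (g : Polynomial K) (S : Set K) (hS : ∀ ε > 0, ∃ u ∈ S, u ≠ 0 ∧ v u < ε) (C : ℝ) (J : ℕ)
    (h : ∀ u ∈ S, v (g.eval u) ≤ C * v u ^ J) : ∀ m < J, g.coeff m = 0 := by
  rw [← Polynomial.X_pow_dvd_iff]
  suffices ∀ s ≤ J, Polynomial.X ^ s ∣ g from this J le_rfl
  intro s
  induction s with
  | zero => intro _; simp
  | succ s ih =>
    intro hs
    obtain ⟨q, rfl⟩ := ih (by omega)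
    rw [pow_succ]
    refine mul_dvd_mul_left _ ?_
    obtain ⟨q', hq'⟩ : Polynomial.X ∣ q - Polynomial.C (q.coeff 0) := by
      rw [Polynomial.X_dvd_iff]; simp
    obtain ⟨C₁, hC₁, hb⟩ := v.exists_eval_le q' 1
    rw [Polynomial.X_dvd_iff]
    by_contra h0
    have hpos : 0 < v (q.coeff 0) := v.pos h0
    obtain ⟨u, huS, hu0, hu⟩ := hS (min 1 (v (q.coeff 0) / (|C| + C₁ + 1))) (by positivity)
    obtain ⟨hu1, hu2⟩ := lt_min_iff.1 hu
    rw [lt_div_iff₀ (by positivity)] at hu2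
    have hv : 0 < v u := v.pos hu0
    have h1 := h u huS
    have h2 : v (q.eval u) ≤ |C| * v u := by
      rw [Polynomial.eval_mul, Polynomial.eval_pow, Polynomial.eval_X, map_mul, map_pow] at h1
      obtain ⟨i, rfl⟩ := Nat.exists_eq_add_of_le hs
      have h3 : v u ^ s * v (q.eval u) ≤ v u ^ s * (|C| * v u) := by
        refine h1.trans ?_
        rw [pow_add, pow_succ]
        have h4 : v u ^ i ≤ 1 := pow_le_one₀ hv.le hu1.le
        have h5 : C * (v u ^ s * v u * v u ^ i) ≤ |C| * (v u ^ s * v u * 1) :=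
          mul_le_mul (le_abs_self C) (mul_le_mul_of_nonneg_left h4 (by positivity))
            (by positivity) (by positivity)
        linarith
      exact le_of_mul_le_mul_left h3 (by positivity)
    have h3 : q.coeff 0 = q.eval u - u * q'.eval u := by
      have := congrArg (Polynomial.eval u) hq'
      rw [Polynomial.eval_sub, Polynomial.eval_C, Polynomial.eval_mul, Polynomial.eval_X] at this
      rw [← this]
      ring
    have h4 : v (q.coeff 0) ≤ |C| * v u + v u * C₁ := by
      rw [h3]
      refine (v.sub_le_add _ _).trans (add_le_add h2 ?_)
      rw [map_mul]
      exact mul_le_mul_of_nonneg_left (hb u hu1.le) hv.le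
    nlinarith

/-- A form of van der Waerden's theorem, with monochromatic progressions arbitrarily far away but
with a fixed common difference and a fixed colour. -/
theorem exists_mono_progressions {κ : Type*} [Finite κ] (c : ℕ → κ) (J e : ℕ) :
    ∃ D ≠ 0, ∃ x : κ, ∀ N, ∃ n ≥ N, ∀ j ≤ J, c (n + j * (e * D)) = x := by
  obtain ⟨ι, _, hι⟩ := Combinatorics.Line.exists_mono_in_high_dimension (Fin (J + 1)) κ
  classical
  have key (N : ℕ) : ∃ y : Fin (Fintype.card ι + 1) × κ, y.1.1 ≠ 0 ∧
      ∃ n ≥ N, ∀ j ≤ J, c (n + j * (e * y.1.1)) = y.2 := by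
    obtain ⟨l, x, hl⟩ := hι fun a => c (N + e * ∑ i, (a i : ℕ))
    let D := (Finset.univ.filter fun i => l.idxFun i = none).card
    have hD : D ≤ Fintype.card ι := Finset.card_le_univ _
    refine ⟨(⟨D, by omega⟩, x), ?_, N + e * ∑ i ∈ Finset.univ.filter (fun i => l.idxFun i ≠ none),
      (l 0 i : ℕ), by omega, fun j hj => ?_⟩
    · obtain ⟨i, hi⟩ := l.proper
      exact Finset.card_ne_zero_of_mem (Finset.mem_filter.2 ⟨Finset.mem_univ i, hi⟩)
    · rw [← hl ⟨j, by omega⟩]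
      congr 1
      rw [← Finset.sum_filter_add_sum_filter_not Finset.univ (fun i => l.idxFun i = none)]
      have h1 : ∑ i ∈ Finset.univ.filter (fun i => l.idxFun i = none),
          ((l ⟨j, by omega⟩ i : Fin (J + 1)) : ℕ) = D * j := by
        rw [Finset.sum_congr rfl (g := fun _ => j)]
        · rw [Finset.sum_const, smul_eq_mul]
        · intro i hi
          rw [Combinatorics.Line.apply_none _ _ _ (Finset.mem_filter.1 hi).2]
      have h2 : ∑ i ∈ Finset.univ.filter (fun i => ¬ l.idxFun i = none),
          ((l ⟨j, by omega⟩ i : Fin (J + 1)) : ℕ) =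
          ∑ i ∈ Finset.univ.filter (fun i => l.idxFun i ≠ none), (l 0 i : ℕ) := by
        refine Finset.sum_congr rfl fun i hi => ?_
        obtain ⟨y, hy⟩ := Option.ne_none_iff_exists'.1 (Finset.mem_filter.1 hi).2
        rw [Combinatorics.Line.apply_some hy, Combinatorics.Line.apply_some hy]
      rw [h1, h2]
      ring
  choose y hy using key
  obtain ⟨y₀, hy₀⟩ := Finite.exists_infinite_fiber y
  rw [Set.infinite_coe_iff] at hy₀
  obtain ⟨N₀, hN₀⟩ := hy₀.nonempty
  refine ⟨y₀.1.1, by rw [← (show y N₀ = y₀ from hN₀)]; exact (hy N₀).1, y₀.2, fun N => ?_⟩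
  obtain ⟨N', hN', hlt⟩ := hy₀.exists_gt N
  obtain ⟨-, n, hn, h⟩ := hy N'
  rw [show y N' = y₀ from hN'] at h
  exact ⟨n, by omega, h⟩

theorem PowerSeries.eval_trunc {K : Type*} [Field K] (J : ℕ) (ψ : PowerSeries K) (u : K) :
    (PowerSeries.trunc J ψ).eval u = ∑ m ∈ Finset.range J, PowerSeries.coeff m ψ * u ^ m :=
  PowerSeries.eval₂_trunc_eq_sum_range u (RingHom.id K) J ψ

theorem coeff_eq_zero_of_progression_approx {k K : Type*} [Field k] [Field K]
    [CharZero K] [Algebra.IsAlgebraic ℚ K] [Algebra k K] (v : AbsoluteValue K ℝ) (t : k)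
    (ρ τ : K) (hρ : ρ ≠ 0) (hτ : τ ≠ 0) (e : ℕ) (he : e ≠ 0) (hτe : τ ^ e = algebraMap k K t)
    (hvτ : v τ < 1) (M : ℕ) (θ : ℝ) (hθ0 : 0 < θ)
    (hθ : ∀ (Q : ℕ) (y : ℕ → k), Q ≠ 0 → ExpBdd Q M (fun n => algebraMap k K (y n)) →
      ∃ c : ℝ, 0 < c ∧ ∀ n, y n ≠ 0 → c * θ ^ n ≤ v (algebraMap k K (y n)))
    (J : ℕ) (hJ : v τ ^ J < θ) (J' : ℕ) (hJ' : J ≤ J') (D : ℕ) (hD : D ≠ 0)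
    (ψ : PowerSeries K) (C : ℝ) (a : ℕ → k) (Q : ℕ) (hQ : Q ≠ 0) (hM : M ≠ 0)
    (ha : ExpBdd Q M (fun n => algebraMap k K (a n)))
    (h : ∀ N, ∃ n ≥ N, ∀ j ≤ J, v (algebraMap k K (a (n + j * (e * D))) -
      (PowerSeries.trunc J' ψ).eval (ρ * τ ^ (n + j * (e * D)))) ≤
        C * v (ρ * τ ^ (n + j * (e * D))) ^ J') :
    ∀ m, J ≤ m → m < J' → PowerSeries.coeff m ψ = 0 := by
  have hvτ0 : 0 < v τ := v.pos hτ
  have hvρ0 : 0 < v ρ := v.pos hρ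
  let p : Polynomial k := ∏ m ∈ Finset.range J, (Polynomial.X - Polynomial.C (t ^ (D * m)))
  have hp : p.natDegree = J := by
    simp only [p]
    rw [Polynomial.natDegree_prod_of_monic _ _ fun i _ => Polynomial.monic_X_sub_C _]
    simp only [Polynomial.natDegree_X_sub_C, Finset.sum_const, Finset.card_range, smul_eq_mul,
      mul_one]
  let w : ℕ → k := fun n => ∑ j ∈ Finset.range (J + 1), p.coeff j * a (n + j * (e * D))
  obtain ⟨Q', hQ', hw⟩ : ∃ Q' : ℕ, Q' ≠ 0 ∧ ExpBdd Q' M (fun n => algebraMap k K (w n)) := by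
    obtain ⟨Q', hQ', h'⟩ := ExpBdd.exists_sum (Finset.range (J + 1)) M
      (fun j n => algebraMap k K (p.coeff j) * algebraMap k K (a (n + j * (e * D))))
      (fun j _ => ExpBdd.exists_const_mul (mul_ne_zero hQ (pow_ne_zero _ hM))
        (ha.shift (j * (e * D))) _)
    exact ⟨Q', hQ', by simpa only [w, map_sum, map_mul] using h'⟩
  obtain ⟨c, hc0, hc⟩ := hθ Q' w hQ' hw
  let s : K := algebraMap k K t ^ D
  let q : Polynomial K := p.map (algebraMap k K)
  have hq : q.natDegree = J := by rw [Polynomial.natDegree_map, hp]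
  have hqs (m : ℕ) : q.eval (s ^ m) = ∏ i ∈ Finset.range J, (s ^ m - s ^ i) := by
    simp only [q, p, s, Polynomial.map_prod, Polynomial.eval_prod]
    refine Finset.prod_congr rfl fun i _ => ?_
    simp [pow_mul]
  let g : Polynomial K := ∑ m ∈ Finset.range J',
    Polynomial.monomial m (PowerSeries.coeff m ψ * q.eval (s ^ m))
  have hg (m : ℕ) (hm : m < J') : g.coeff m = PowerSeries.coeff m ψ * q.eval (s ^ m) := by
    simp only [g, Polynomial.finsetSum_coeff, Polynomial.coeff_monomial]
    rw [Finset.sum_ite_eq' (Finset.range J') m, if_pos (Finset.mem_range.2 hm)]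
  have hgeval (n : ℕ) : g.eval (ρ * τ ^ n) = ∑ j ∈ Finset.range (J + 1),
      algebraMap k K (p.coeff j) *
        (PowerSeries.trunc J' ψ).eval (ρ * τ ^ (n + j * (e * D))) := by
    simp only [g, Polynomial.eval_finsetSum, Polynomial.eval_monomial, PowerSeries.eval_trunc,
      Finset.mul_sum]
    rw [Finset.sum_comm]
    refine Finset.sum_congr rfl fun m _ => ?_
    rw [Polynomial.eval_eq_sum_range, hq, Finset.mul_sum, Finset.sum_mul]
    refine Finset.sum_congr rfl fun j _ => ?_
    have : τ ^ (n + j * (e * D)) = τ ^ n * s ^ j := by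
      simp only [s]
      rw [← hτe]
      ring
    rw [this, Polynomial.coeff_map]
    ring
  have hgX : Polynomial.X ^ J ∣ g := by
    rw [Polynomial.X_pow_dvd_iff]
    intro m hm
    rw [hg m (hm.trans_le hJ'), hqs, Finset.prod_eq_zero (Finset.mem_range.2 hm) (sub_self _),
      mul_zero]
  have hu (n : ℕ) : v (ρ * τ ^ n) = v ρ * v τ ^ n := by rw [map_mul, map_pow]
  have hule (n : ℕ) : v (ρ * τ ^ n) ≤ v ρ := by
    rw [hu]
    exact mul_le_of_le_one_right hvρ0.le (pow_le_one₀ hvτ0.le hvτ.le)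
  let C' : ℝ := ∑ j ∈ Finset.range (J + 1), v (algebraMap k K (p.coeff j)) * |C|
  have hC' : 0 ≤ C' := Finset.sum_nonneg fun j _ => by positivity
  have happrox (n : ℕ) (hn : ∀ j ≤ J, v (algebraMap k K (a (n + j * (e * D))) -
      (PowerSeries.trunc J' ψ).eval (ρ * τ ^ (n + j * (e * D)))) ≤
        C * v (ρ * τ ^ (n + j * (e * D))) ^ J') :
      v (algebraMap k K (w n) - g.eval (ρ * τ ^ n)) ≤ C' * v (ρ * τ ^ n) ^ J' := by
    have hwn : algebraMap k K (w n) = ∑ j ∈ Finset.range (J + 1),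
        algebraMap k K (p.coeff j) * algebraMap k K (a (n + j * (e * D))) := by
      simp only [w, map_sum, map_mul]
    rw [hgeval, hwn, ← Finset.sum_sub_distrib]
    refine (v.sum_le _ _).trans ?_
    rw [Finset.sum_mul]
    refine Finset.sum_le_sum fun j hj => ?_
    rw [← mul_sub, map_mul, mul_assoc]
    refine mul_le_mul_of_nonneg_left ?_ (v.nonneg _)
    refine (hn j (Nat.lt_succ_iff.1 (Finset.mem_range.1 hj))).trans ?_
    refine mul_le_mul (le_abs_self C) ?_ (by positivity) (abs_nonneg C)
    refine pow_le_pow_left₀ (v.nonneg _) ?_ _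
    rw [hu, hu]
    exact mul_le_mul_of_nonneg_left (pow_le_pow_of_le_one hvτ0.le hvτ.le (by omega)) hvρ0.le
  obtain ⟨C₂, hC₂, hgle⟩ := v.exists_eval_le_of_X_pow_dvd J g hgX (v ρ)
  let B : ℝ := (C' * v ρ ^ (J' - J) + C₂) * v ρ ^ J
  obtain ⟨N₀, hN₀⟩ : ∃ N₀, ∀ n ≥ N₀, B * (v τ ^ J) ^ n < c * θ ^ n := by
    have h1 : Filter.Tendsto (fun n : ℕ => B * (v τ ^ J / θ) ^ n) Filter.atTop (nhds (B * 0)) :=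
      (tendsto_pow_atTop_nhds_zero_of_lt_one (by positivity) ((div_lt_one hθ0).2 hJ)).const_mul B
    rw [mul_zero] at h1
    obtain ⟨N₀, hN₀⟩ := Filter.eventually_atTop.1 (h1.eventually_lt_const hc0)
    refine ⟨N₀, fun n hn => ?_⟩
    have := hN₀ n hn
    rwa [div_pow, ← mul_div_assoc, div_lt_iff₀ (by positivity)] at this
  have hw0 (n : ℕ) (hnN : N₀ ≤ n) (hn : ∀ j ≤ J, v (algebraMap k K (a (n + j * (e * D))) -
      (PowerSeries.trunc J' ψ).eval (ρ * τ ^ (n + j * (e * D)))) ≤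
        C * v (ρ * τ ^ (n + j * (e * D))) ^ J') : w n = 0 := by
    by_contra hne
    refine absurd (hc n hne) (not_le.2 (lt_of_le_of_lt ?_ (hN₀ n hnN)))
    have h1 : v (algebraMap k K (w n)) ≤ C' * v (ρ * τ ^ n) ^ J' + C₂ * v (ρ * τ ^ n) ^ J := by
      calc v (algebraMap k K (w n))
          = v ((algebraMap k K (w n) - g.eval (ρ * τ ^ n)) + g.eval (ρ * τ ^ n)) := by
            rw [sub_add_cancel]
        _ ≤ _ := (v.add_le _ _).trans (add_le_add (happrox n hn) (hgle _ (hule n)))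
    refine h1.trans ?_
    have h2 : v (ρ * τ ^ n) ^ J' ≤ v ρ ^ (J' - J) * v (ρ * τ ^ n) ^ J := by
      conv_lhs => rw [← Nat.sub_add_cancel hJ', pow_add]
      exact mul_le_mul_of_nonneg_right (pow_le_pow_left₀ (v.nonneg _) (hule n) _) (by positivity)
    calc C' * v (ρ * τ ^ n) ^ J' + C₂ * v (ρ * τ ^ n) ^ J
        ≤ C' * (v ρ ^ (J' - J) * v (ρ * τ ^ n) ^ J) + C₂ * v (ρ * τ ^ n) ^ J := by gcongr
      _ = B * (v τ ^ J) ^ n := by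
        rw [hu]
        simp only [B]
        ring
  have hcoeff := v.coeff_eq_zero_of_eval_le g
    {u | ∃ n, u = ρ * τ ^ n ∧ w n = 0 ∧ v (algebraMap k K (w n) - g.eval (ρ * τ ^ n)) ≤
      C' * v (ρ * τ ^ n) ^ J'} (by
      intro ε hε
      have h1 : Filter.Tendsto (fun n : ℕ => v ρ * v τ ^ n) Filter.atTop (nhds (v ρ * 0)) :=
        (tendsto_pow_atTop_nhds_zero_of_lt_one hvτ0.le hvτ).const_mul _
      rw [mul_zero] at h1
      obtain ⟨N₁, hN₁⟩ := Filter.eventually_atTop.1 (h1.eventually_lt_const hε)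
      obtain ⟨n, hn, hn'⟩ := h (max N₀ N₁)
      refine ⟨ρ * τ ^ n, ⟨n, rfl, hw0 n (le_of_max_le_left hn) hn', happrox n hn'⟩,
        mul_ne_zero hρ (pow_ne_zero _ hτ), ?_⟩
      rw [hu]
      exact hN₁ n (le_of_max_le_right hn)) C' J' (by
      rintro _ ⟨n, rfl, h1, h2⟩
      rwa [h1, map_zero, zero_sub, v.map_neg] at h2)
  intro m hm hm'
  have h1 := hcoeff m hm'
  rw [hg m hm', hqs] at h1
  refine (mul_eq_zero.1 h1).resolve_right (Finset.prod_ne_zero_iff.2 fun i hi => ?_)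
  rw [Finset.mem_range] at hi
  intro h0
  have h2 : v s ^ m = v s ^ i := by rw [← v.map_pow, ← v.map_pow, sub_eq_zero.1 h0]
  have h3 : v s = v τ ^ (e * D) := by
    simp only [s]
    rw [← hτe, ← pow_mul, map_pow]
  rw [h3] at h2
  exact (pow_lt_pow_right_of_lt_one₀ (by positivity)
    (pow_lt_one₀ hvτ0.le hvτ (mul_ne_zero he hD)) (hi.trans_le hm)).ne h2

theorem exists_quadratic_puiseux {k K : Type*} [Field k] [NumberField k] [Field K]
    [CharZero K] [IsAlgClosed K] [Algebra.IsAlgebraic ℚ K] [Algebra k K] (v : AbsoluteValue K ℝ)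
    (hv : HasLiouvilleBound v) (t : k) (ht : t ≠ 0) (hvt : v (algebraMap k K t) < 1)
    (x₀ : K) (hx₀ : x₀ ≠ 0) (f : Polynomial (Polynomial K)) (hf : f.Monic)
    (hfd : f.natDegree ≠ 0) (a b : ℕ → k) (α β : ℕ → K)
    (hα : ∀ n, f.eval₂ (Polynomial.evalRingHom (x₀ * algebraMap k K t ^ n)) (α n) = 0)
    (hβ : ∀ n, f.eval₂ (Polynomial.evalRingHom (x₀ * algebraMap k K t ^ n)) (β n) = 0)
    (ha : ∀ n, algebraMap k K (a n) = α n + β n) (hb : ∀ n, algebraMap k K (b n) = α n * β n) :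
    ∃ (e : ℕ) (_ : e ≠ 0) (φ : PowerSeries K) (A B : Polynomial K),
      φ ^ 2 - (A : PowerSeries K) * φ + (B : PowerSeries K) = 0 ∧
      f.eval₂ (Polynomial.coeToPowerSeries.ringHom.comp (Polynomial.expand K e : _ →+* _)) φ = 0 :=
      by
  have hroot (z : ℕ → K)
      (hz : ∀ n, f.eval₂ (Polynomial.evalRingHom (x₀ * algebraMap k K t ^ n)) (z n) = 0) :
      ∃ Q M : ℕ, Q ≠ 0 ∧ M ≠ 0 ∧ ExpBdd Q M z := by
    refine ExpBdd.exists_of_root (r := f.natDegree)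
      (fun i n => (f.coeff i).eval (x₀ * algebraMap k K t ^ n)) z (fun i => ?_) fun n => ?_
    · obtain ⟨M, hM, h⟩ := ExpBdd.exists_pow (algebraMap k K t)
      obtain ⟨Q, hQ, h⟩ := h.exists_const_mul one_ne_zero x₀
      exact h.exists_eval hQ hM _
    · have := hz n
      conv at this => rw [hf.as_sum]
      rw [Polynomial.eval₂_add, Polynomial.eval₂_X_pow, Polynomial.eval₂_finsetSum] at this
      simpa only [Polynomial.eval₂_mul, Polynomial.eval₂_C, Polynomial.eval₂_X_pow,
        Polynomial.coe_evalRingHom] using this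
  obtain ⟨Q₁, M₁, hQ₁, hM₁, h₁⟩ := hroot α hα
  obtain ⟨Q₂, M₂, hQ₂, hM₂, h₂⟩ := hroot β hβ
  have hM : M₁ * M₂ ≠ 0 := mul_ne_zero hM₁ hM₂
  have hab : ExpBdd (2 * Q₁ * Q₂) (M₁ * M₂) (fun n => algebraMap k K (a n)) := by
    simp only [ha]
    exact (h₁.mono dvd_rfl hQ₁ (Dvd.intro _ rfl) hM).add hQ₁ hQ₂
      (h₂.mono dvd_rfl hQ₂ (Dvd.intro_left _ rfl) hM)
  have hbb : ExpBdd (Q₁ * Q₂) (M₁ * M₂) (fun n => algebraMap k K (b n)) := by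
    simp only [hb]
    exact h₁.mul h₂
  obtain ⟨θ, hθ0, hθ⟩ := hv.exists_le (k := k) v (M₁ * M₂) hM
  obtain ⟨e, he, hs⟩ := PowerSeries.exists_expandHom_splits
    (f.map Polynomial.coeToPowerSeries.ringHom) (hf.map _)
  let E : Polynomial K →+* Polynomial K := (Polynomial.expand K e : _ →+* _)
  have hE : (PowerSeries.expandHom K e he).comp Polynomial.coeToPowerSeries.ringHom =
      Polynomial.coeToPowerSeries.ringHom.comp E := by
    refine Polynomial.ringHom_ext (fun r => ?_) ?_ <;>
      simp [E, PowerSeries.expandHom_apply, PowerSeries.expand_C, PowerSeries.expand_X]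
  rw [Polynomial.map_map, hE, ← Polynomial.map_map] at hs
  have hfE : (f.map E).Monic := hf.map _
  have hprod := hs.eq_prod_roots_of_monic (hfE.map _)
  set L := ((f.map E).map Polynomial.coeToPowerSeries.ringHom).roots.toList with hL
  let φ : Fin L.length → PowerSeries K := L.get
  have hφ : (f.map E).map Polynomial.coeToPowerSeries.ringHom =
      ∏ i, (Polynomial.X - Polynomial.C (φ i)) := by
    rw [hprod, ← Multiset.coe_toList ((f.map E).map Polynomial.coeToPowerSeries.ringHom).roots,
      ← hL, Multiset.map_coe, Multiset.prod_coe, ← List.prod_ofFn]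
    conv_lhs => rw [← List.ofFn_get L, List.map_ofFn]
    rfl
  have hr : L.length ≠ 0 := by
    intro h0
    apply hfd
    have := congrArg Polynomial.natDegree hφ
    rw [Polynomial.natDegree_prod_of_monic _ _ fun i _ => Polynomial.monic_X_sub_C _,
      (hfE).natDegree_map, hf.natDegree_map] at this
    simpa [h0] using this
  obtain ⟨ρ, hρ⟩ := IsAlgClosed.exists_pow_nat_eq x₀ (Nat.pos_of_ne_zero he)
  obtain ⟨τ, hτ⟩ := IsAlgClosed.exists_pow_nat_eq (algebraMap k K t) (Nat.pos_of_ne_zero he)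
  have hρ0 : ρ ≠ 0 := by
    rintro rfl
    exact hx₀ (by rw [← hρ, zero_pow he])
  have hτ0 : τ ≠ 0 := by
    rintro rfl
    rw [zero_pow he] at hτ
    exact ht ((map_eq_zero _).1 hτ.symm)
  have hvτ : v τ < 1 := by
    rw [← hτ, v.map_pow] at hvt
    exact (pow_lt_one_iff_of_nonneg (v.nonneg _) he).1 hvt
  obtain ⟨J, hJ⟩ := exists_pow_lt_of_lt_one hθ0 hvτ
  have hu (n : ℕ) : (ρ * τ ^ n) ^ e = x₀ * algebraMap k K t ^ n := by
    rw [mul_pow, hρ, ← pow_mul, mul_comm n, pow_mul, hτ]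
  have hEz (n : ℕ) (z : K) : (f.map E).eval₂ (Polynomial.evalRingHom (ρ * τ ^ n)) z =
      f.eval₂ (Polynomial.evalRingHom (x₀ * algebraMap k K t ^ n)) z := by
    rw [Polynomial.eval₂_map]
    congr 1
    refine RingHom.ext fun p => ?_
    simp [E, Polynomial.expand_eval, hu]
  have hvan (J' : ℕ) : ∃ i : Fin L.length × Fin L.length, ∀ m, J ≤ m → m < J + J' →
      PowerSeries.coeff m (φ i.1 + φ i.2) = 0 ∧ PowerSeries.coeff m (φ i.1 * φ i.2) = 0 := by
    obtain ⟨C, hC, hap⟩ := v.exists_pair_approx hr _ hfE φ hφ (J + J') (v ρ)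
    have hap' (n : ℕ) := hap (ρ * τ ^ n) (α n) (β n) (mul_ne_zero hρ0 (pow_ne_zero _ hτ0)) (by
      rw [v.map_mul, v.map_pow]
      exact mul_le_of_le_one_right (v.nonneg _) (pow_le_one₀ (v.nonneg _) hvτ.le))
      (by rw [hEz, hα]) (by rw [hEz, hβ])
    choose c hc using hap'
    obtain ⟨D, hD, x, hx⟩ := exists_mono_progressions c J e
    refine ⟨x, fun m hm hm' => ⟨?_, ?_⟩⟩
    · refine coeff_eq_zero_of_progression_approx v t ρ τ hρ0 hτ0 e he hτ hvτ (M₁ * M₂) θ hθ0 hθ J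
        hJ (J + J') (Nat.le_add_right _ _) D hD _ C a _ (by positivity) hM hab (fun N => ?_) m hm
        hm'
      obtain ⟨n, hn, hn'⟩ := hx N
      refine ⟨n, hn, fun j hj => ?_⟩
      rw [ha, ← hn' j hj]
      exact (hc _).1
    · refine coeff_eq_zero_of_progression_approx v t ρ τ hρ0 hτ0 e he hτ hvτ (M₁ * M₂) θ hθ0 hθ J
        hJ (J + J') (Nat.le_add_right _ _) D hD _ C b _ (by positivity) hM hbb (fun N => ?_) m hm
        hm'
      obtain ⟨n, hn, hn'⟩ := hx N
      refine ⟨n, hn, fun j hj => ?_⟩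
      rw [hb, ← hn' j hj]
      exact (hc _).2
  choose x hx using hvan
  obtain ⟨i, hi⟩ := Finite.exists_infinite_fiber x
  rw [Set.infinite_coe_iff] at hi
  have hcoe (ψ : PowerSeries K) (hψ : ∀ m, J ≤ m → PowerSeries.coeff m ψ = 0) :
      (PowerSeries.trunc J ψ : PowerSeries K) = ψ := by
    ext m
    rw [Polynomial.coeff_coe, PowerSeries.coeff_trunc]
    split_ifs with h
    · rfl
    · exact (hψ m (not_lt.1 h)).symm
  have hi' (m : ℕ) (hm : J ≤ m) : PowerSeries.coeff m (φ i.1 + φ i.2) = 0 ∧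
      PowerSeries.coeff m (φ i.1 * φ i.2) = 0 := by
    obtain ⟨J', hJ', hlt⟩ := hi.exists_gt m
    rw [← show x J' = i from hJ']
    exact hx J' m hm (by omega)
  refine ⟨e, he, φ i.1, PowerSeries.trunc J (φ i.1 + φ i.2), PowerSeries.trunc J (φ i.1 * φ i.2),
    ?_, ?_⟩
  · rw [hcoe _ fun m hm => (hi' m hm).1, hcoe _ fun m hm => (hi' m hm).2]
    ring
  · rw [← Polynomial.eval_map, ← Polynomial.map_map]
    change Polynomial.eval _ ((f.map E).map _) = 0
    rw [hφ, Polynomial.eval_prod]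
    exact Finset.prod_eq_zero (Finset.mem_univ i.1) (by simp)

/-- The polynomial `F(x, 1, Z)` in `Z` with coefficients polynomials in `x`. -/
def affinePoly {k : Type*} [Field k] (F : MvPolynomial (Fin 3) k) : Polynomial (Polynomial k) :=
  aeval ![Polynomial.C Polynomial.X, 1, Polynomial.X] F

theorem affinePoly_eval₂ {k S : Type*} [Field k] [CommRing S] (F : MvPolynomial (Fin 3) k)
    (g : Polynomial k →+* S) (z : S) :
    (affinePoly F).eval₂ g z = F.eval₂ (g.comp Polynomial.C) ![g Polynomial.X, 1, z] := by
  have : ((Polynomial.eval₂RingHom g z).comp (aeval (R := k)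
      ![(Polynomial.C Polynomial.X : Polynomial (Polynomial k)), 1, Polynomial.X] :
        MvPolynomial (Fin 3) k →+* _)) =
      eval₂Hom (g.comp Polynomial.C) ![g Polynomial.X, 1, z] := by
    refine MvPolynomial.ringHom_ext (fun r => ?_) fun i => ?_
    · simp [Polynomial.algebraMap_apply]
    · fin_cases i <;> simp
  exact RingHom.congr_fun this F

theorem coeff_affinePoly {k : Type*} [Field k] {d : ℕ} {F : MvPolynomial (Fin 3) k}
    (hF : F.IsHomogeneous d) (m : Fin 3 →₀ ℕ) (hm : coeff m F ≠ 0) :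
    ((affinePoly F).coeff (m 2)).coeff (m 0) = coeff m F := by
  have hdeg (n : Fin 3 →₀ ℕ) (hn : coeff n F ≠ 0) : n 0 + n 1 + n 2 = d := by
    have := hF hn
    rw [Finsupp.weight_apply, Finsupp.sum_fintype _ _ (by simp), Fin.sum_univ_three] at this
    simpa using this
  have hterm (n : Fin 3 →₀ ℕ) (r : k) : ((aeval (R := k)
      ![(Polynomial.C Polynomial.X : Polynomial (Polynomial k)), 1, Polynomial.X]
        (monomial n r)).coeff (m 2)).coeff (m 0) = if m 2 = n 2 ∧ m 0 = n 0 then r else 0 := by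
    rw [aeval_monomial, Finsupp.prod_fintype _ _ (by simp), Fin.prod_univ_three,
      IsScalarTower.algebraMap_apply k (Polynomial k) (Polynomial (Polynomial k)),
      Polynomial.algebraMap_eq, Polynomial.algebraMap_eq]
    have : (Polynomial.C (Polynomial.C r) : Polynomial (Polynomial k)) *
        (![(Polynomial.C Polynomial.X : Polynomial (Polynomial k)), 1, Polynomial.X] 0 ^ n 0 *
          ![(Polynomial.C Polynomial.X : Polynomial (Polynomial k)), 1, Polynomial.X] 1 ^ n 1 *
          ![(Polynomial.C Polynomial.X : Polynomial (Polynomial k)), 1, Polynomial.X] 2 ^ n 2) =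
        Polynomial.C (Polynomial.C r * Polynomial.X ^ n 0) * Polynomial.X ^ n 2 := by
      simp [mul_assoc]
    rw [this, Polynomial.coeff_C_mul_X_pow]
    split_ifs with h1 h2 h2
    · rw [Polynomial.coeff_C_mul_X_pow, if_pos h2.2]
    · rw [Polynomial.coeff_C_mul_X_pow, if_neg fun h => h2 ⟨h1, h⟩]
    · exact absurd h2.1 h1
    · simp
  conv_lhs => rw [affinePoly, F.as_sum, map_sum]
  rw [Polynomial.finsetSum_coeff, Polynomial.finsetSum_coeff]
  simp only [hterm]
  rw [Finset.sum_eq_single m]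
  · simp
  · intro n hn hnm
    refine if_neg fun h => hnm ?_
    have h1 := hdeg n (mem_support_iff.1 hn)
    have h2 := hdeg m hm
    ext i
    fin_cases i
    · exact h.2.symm
    · change n 1 = m 1
      omega
    · exact h.1.symm
  · intro h
    exact absurd (mem_support_iff.2 hm) h

theorem exists_conjugate {k K : Type*} [Field k] [Field K] [Algebra k K] (α : K)
    (hα : IsIntegral k α) (h : (minpoly k α).natDegree ≤ 2) :
    ∃ (a b : k) (β : K), algebraMap k K a = α + β ∧ algebraMap k K b = α * β ∧
      ∀ g : Polynomial k, Polynomial.aeval α g = 0 → Polynomial.aeval β g = 0 := by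
  have hm := minpoly.monic hα
  have h0 := minpoly.aeval k α
  have hpos := minpoly.natDegree_pos hα
  rw [Polynomial.aeval_eq_sum_range] at h0
  obtain h1 | h1 : (minpoly k α).natDegree = 1 ∨ (minpoly k α).natDegree = 2 := by omega
  · have hc : (minpoly k α).coeff 1 = 1 := by
      conv_lhs => rw [← h1]
      exact hm
    rw [h1, Finset.sum_range_succ, Finset.sum_range_one, hc, one_smul, pow_zero, pow_one,
      Algebra.smul_def, mul_one] at h0
    have hα' : α = algebraMap k K (-(minpoly k α).coeff 0) := by
      rw [map_neg]
      linear_combination h0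
    refine ⟨-(minpoly k α).coeff 0 + -(minpoly k α).coeff 0,
      -(minpoly k α).coeff 0 * -(minpoly k α).coeff 0, α, ?_, ?_, fun g hg => hg⟩
    · rw [map_add, ← hα']
    · rw [map_mul, ← hα']
  · have hc : (minpoly k α).coeff 2 = 1 := by
      conv_lhs => rw [← h1]
      exact hm
    rw [h1, Finset.sum_range_succ, Finset.sum_range_succ, Finset.sum_range_one, hc, one_smul,
      pow_zero, pow_one, Algebra.smul_def, Algebra.smul_def, mul_one] at h0
    refine ⟨-(minpoly k α).coeff 1, (minpoly k α).coeff 0,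
      -algebraMap k K ((minpoly k α).coeff 1) - α, ?_, ?_, fun g hg => ?_⟩
    · rw [map_neg]
      ring
    · linear_combination h0
    · obtain ⟨q, rfl⟩ := minpoly.dvd k α hg
      rw [map_mul]
      refine mul_eq_zero_of_left ?_ _
      rw [Polynomial.aeval_eq_sum_range, h1, Finset.sum_range_succ, Finset.sum_range_succ,
        Finset.sum_range_one, hc, one_smul, pow_zero, pow_one, Algebra.smul_def,
        Algebra.smul_def, mul_one]
      linear_combination h0

theorem PowerSeries.aeval_algebraMap_X {K : Type*} [Field K] (p : Polynomial K) :
    Polynomial.aeval (algebraMap (PowerSeries K) (FractionRing (PowerSeries K)) PowerSeries.X) p =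
      algebraMap (PowerSeries K) (FractionRing (PowerSeries K)) (p : PowerSeries K) := by
  rw [Polynomial.aeval_algebraMap_apply]
  congr 1
  have : (Polynomial.aeval (R := K) (PowerSeries.X : PowerSeries K) :
      Polynomial K →+* PowerSeries K) = Polynomial.coeToPowerSeries.ringHom := by
    refine Polynomial.ringHom_ext (fun r => ?_) ?_ <;> simp
  exact RingHom.congr_fun this p

theorem false_of_quadratic_points {k K : Type*} [Field k] [NumberField k] [Field K]
    [CharZero K] [IsAlgClosed K] [Algebra.IsAlgebraic ℚ K] [Algebra k K]
    [Algebra.IsAlgebraic k K] (d : ℕ) (hd : 5 ≤ d)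
    (F : MvPolynomial (Fin 3) k) (hF : F.IsHomogeneous d) (N : ℕ)
    (hN : ∀ i, X i ^ N ∈
      Ideal.span (Set.range fun j => pderiv j (map (algebraMap k K) F)))
    (m : Fin 3 →₀ ℕ) (hm : d - 1 ≤ m 2) (hmF : coeff m F ≠ 0)
    (v : AbsoluteValue K ℝ) (hv : HasLiouvilleBound v) (t : k) (ht : t ≠ 0)
    (hvt : v (algebraMap k K t) < 1) (x₀ : k) (hx₀ : x₀ ≠ 0) (z : ℕ → K)
    (hz : ∀ n, aeval ![algebraMap k K (x₀ * t ^ n), 1, z n] F = 0)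
    (hz2 : ∀ n, (Module.finrank k (IntermediateField.adjoin k {z n})) ≤ 2) : False := by
  let f := affinePoly F
  have hfm : f.coeff (m 2) ≠ 0 := fun h => hmF <| by
    rw [← coeff_affinePoly hF m hmF]
    change (f.coeff (m 2)).coeff (m 0) = 0
    rw [h, Polynomial.coeff_zero]
  have hf0 : f ≠ 0 := fun h => hfm (by rw [h, Polynomial.coeff_zero])
  have hf1 : 1 ≤ f.natDegree := by
    have := Polynomial.le_natDegree_of_ne_zero hfm
    omega
  let h := f.integralNormalization
  have hh : h.Monic := Polynomial.monic_integralNormalization hf0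
  have hhd : h.natDegree ≠ 0 := by
    rw [Polynomial.natDegree_integralNormalization]
    omega
  have hhz (n : ℕ) : Polynomial.aeval
      (algebraMap k K (f.leadingCoeff.eval (x₀ * t ^ n)) * z n)
      (h.map (Polynomial.evalRingHom (x₀ * t ^ n))) = 0 := by
    rw [Polynomial.aeval_def, Polynomial.eval₂_map]
    have h1 := Polynomial.integralNormalization_eval₂_leadingCoeff_mul hf1
      ((algebraMap k K).comp (Polynomial.evalRingHom (x₀ * t ^ n))) (z n)
    rw [affinePoly_eval₂] at h1
    have h2 : ((algebraMap k K).comp (Polynomial.evalRingHom (x₀ * t ^ n))).comp Polynomial.C =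
        algebraMap k K := by
      ext r
      simp
    have h3 : ((algebraMap k K).comp (Polynomial.evalRingHom (x₀ * t ^ n))) Polynomial.X =
        algebraMap k K (x₀ * t ^ n) := by simp
    rw [h2, h3, ← aeval_def, hz, mul_zero] at h1
    exact h1
  have hconj (n : ℕ) := exists_conjugate (k := k)
    (algebraMap k K (f.leadingCoeff.eval (x₀ * t ^ n)) * z n)
    (Algebra.IsIntegral.isIntegral _) (by
      have hzi : IsIntegral k (z n) := Algebra.IsIntegral.isIntegral _
      rw [← IntermediateField.adjoin.finrank (Algebra.IsIntegral.isIntegral _)]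
      refine le_trans ?_ (hz2 n)
      have : FiniteDimensional k (IntermediateField.adjoin k {z n}) :=
        IntermediateField.adjoin.finiteDimensional hzi
      refine Submodule.finrank_mono (R := k) (M := K)
        (s := (IntermediateField.adjoin k _).toSubmodule)
        (t := (IntermediateField.adjoin k {z n}).toSubmodule) ?_
      change IntermediateField.adjoin k _ ≤ IntermediateField.adjoin k {z n}
      rw [IntermediateField.adjoin_simple_le_iff]
      exact mul_mem (IntermediateField.algebraMap_mem _ _)
        (IntermediateField.mem_adjoin_simple_self k _))
  choose a b β ha hb hβ using hconj
  let hK := h.map (Polynomial.mapRingHom (algebraMap k K))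
  have hhK (n : ℕ) (w : K) (hw : Polynomial.aeval w
      (h.map (Polynomial.evalRingHom (x₀ * t ^ n))) = 0) :
      hK.eval₂ (Polynomial.evalRingHom (algebraMap k K x₀ * algebraMap k K t ^ n)) w = 0 := by
    rw [Polynomial.aeval_def, Polynomial.eval₂_map] at hw
    rw [Polynomial.eval₂_map]
    rw [← hw]
    congr 1
    refine Polynomial.ringHom_ext (fun r => ?_) ?_ <;> simp
  obtain ⟨e, he, φ, A, B, hφ, hhφ⟩ := exists_quadratic_puiseux v hv t ht hvt (algebraMap k K x₀)
    ((map_ne_zero _).2 hx₀) hK (hh.map _) (by rwa [hh.natDegree_map]) a b _ β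
    (fun n => hhK n _ (hhz n)) (fun n => hhK n _ (hβ n _ (hhz n))) ha hb
  let ι := algebraMap (PowerSeries K) (FractionRing (PowerSeries K))
  have hι : Function.Injective ι := IsFractionRing.injective _ _
  let l : Polynomial K := Polynomial.expand K e (f.leadingCoeff.map (algebraMap k K))
  have hl : l ≠ 0 := by
    rw [Ne, Polynomial.expand_eq_zero (Nat.pos_of_ne_zero he), Polynomial.map_eq_zero]
    exact Polynomial.leadingCoeff_ne_zero.2 hf0
  have hιl : ι (l : PowerSeries K) ≠ 0 := by
    rw [Ne, map_eq_zero_iff _ hι, Polynomial.coe_eq_zero_iff]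
    exact hl
  let g : Polynomial k →+* FractionRing (PowerSeries K) :=
    (ι.comp (Polynomial.coeToPowerSeries.ringHom.comp (Polynomial.expand K e : _ →+* _))).comp
      (Polynomial.mapRingHom (algebraMap k K))
  have hgl : g f.leadingCoeff = ι (l : PowerSeries K) := rfl
  let ζ := ι φ / ι (l : PowerSeries K)
  have hlζ : ι (l : PowerSeries K) * ζ = ι φ := mul_div_cancel₀ _ hιl
  have hfζ : f.eval₂ g ζ = 0 := by
    have h1 := Polynomial.integralNormalization_eval₂_leadingCoeff_mul hf1 g ζ
    rw [hgl, hlζ] at h1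
    have h2 : f.integralNormalization.eval₂ g (ι φ) = 0 := by
      rw [Polynomial.eval₂_map] at hhφ
      have := congrArg ι hhφ
      rw [Polynomial.hom_eval₂, map_zero] at this
      exact this
    rw [h2] at h1
    exact (mul_eq_zero.1 h1.symm).resolve_left (pow_ne_zero _ hιl)
  refine false_of_quadratic_over_rational (K := K) d hd (map (algebraMap k K) F) (hF.map _) N hN m
    hm
    ?_ e he (ι PowerSeries.X) ζ ?_ ?_ (l ^ 2) (-(A * l)) B (pow_ne_zero 2 hl) ?_
  · rw [coeff_map]
    exact (map_ne_zero _).2 hmF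
  · rw [transcendental_iff]
    intro p hp
    rw [PowerSeries.aeval_algebraMap_X, map_eq_zero_iff _ hι, Polynomial.coe_eq_zero_iff] at hp
    exact hp
  · rw [affinePoly_eval₂] at hfζ
    rw [aeval_def, eval₂_map]
    convert hfζ using 2
    · ext r
      simp only [g, RingHom.comp_apply]
      simp [ι, IsScalarTower.algebraMap_apply K (PowerSeries K) (FractionRing (PowerSeries K))]
    · simp [g]
  · rw [PowerSeries.aeval_algebraMap_X, PowerSeries.aeval_algebraMap_X,
      PowerSeries.aeval_algebraMap_X]
    change ι _ * ζ ^ 2 + ι _ * ζ + ι _ = 0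
    have h1 := congrArg ι hφ
    simp only [map_add, map_sub, map_mul, map_pow, map_zero] at h1
    rw [← hlζ] at h1
    simp only [Polynomial.coe_pow, Polynomial.coe_mul, Polynomial.coe_neg, map_mul, map_pow,
      map_neg]
    linear_combination h1

theorem exists_X_pow_mem_span_pderiv {K : Type*} [Field K] [IsAlgClosed K]
    (F : MvPolynomial (Fin 3) K) (h : ∀ P : Fin 3 → K, P ≠ 0 → ∃ i, eval P (pderiv i F) ≠ 0) :
    ∃ N, ∀ i, X i ^ N ∈ Ideal.span (Set.range fun j => pderiv j F) := by
  have h1 (i : Fin 3) : (X i : MvPolynomial (Fin 3) K) ∈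
      (Ideal.span (Set.range fun j => pderiv j F)).radical := by
    rw [← vanishingIdeal_zeroLocus_eq_radical (K := K), mem_vanishingIdeal_iff]
    intro P hP
    by_cases h0 : P = 0
    · simp [h0]
    · obtain ⟨j, hj⟩ := h P h0
      exact absurd (hP _ (Ideal.subset_span ⟨j, rfl⟩)) hj
  choose n hn using h1
  refine ⟨∑ i, n i, fun i => ?_⟩
  exact Ideal.pow_mem_of_pow_mem _ (hn i)
    (Finset.single_le_sum (fun j _ => Nat.zero_le (n j)) (Finset.mem_univ i))

theorem exists_coeff_ne_zero_of_eval_pderiv_ne_zero {K : Type*} [Field K] {d : ℕ}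
    {F : MvPolynomial (Fin 3) K} (hF : F.IsHomogeneous d) (i : Fin 3)
    (h : eval ![0, 0, 1] (pderiv i F) ≠ 0) : ∃ m : Fin 3 →₀ ℕ, d - 1 ≤ m 2 ∧ coeff m F ≠ 0 := by
  rw [eval_eq'] at h
  obtain ⟨m, -, hm⟩ := Finset.exists_ne_zero_of_sum_ne_zero h
  have h1 := left_ne_zero_of_mul hm
  have h2 := right_ne_zero_of_mul hm
  rw [Fin.prod_univ_three] at h2
  have h3 : m 0 = 0 := by
    by_contra h0
    simp [h0] at h2
  have h4 : m 1 = 0 := by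
    by_contra h0
    simp [h0] at h2
  have h5 : coeff (m + Finsupp.single i 1) F ≠ 0 := by
    intro h0
    rw [coeff_pderiv, h0] at h1
    simp at h1
  refine ⟨m + Finsupp.single i 1, ?_, h5⟩
  have h6 := hF h5
  rw [Finsupp.weight_apply, Finsupp.sum_fintype _ _ (by simp), Fin.sum_univ_three] at h6
  simp only [Pi.one_apply, smul_eq_mul, mul_one, Finsupp.add_apply, h3, h4, zero_add] at h6 ⊢
  have h7 : Finsupp.single i 1 0 + Finsupp.single i 1 1 ≤ 1 := by
    fin_cases i <;> simp
  omega

theorem false_of_infinite_vertical_line {K : Type*} [Field K] [Infinite K] {d : ℕ} (hd : 2 ≤ d)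
    (F : MvPolynomial (Fin 3) K) (hF : F.IsHomogeneous d) (N : ℕ)
    (hN : ∀ i, X i ^ N ∈ Ideal.span (Set.range fun j => pderiv j F)) (x : K)
    (z : ℕ → K) (hz : Function.Injective z) (h : ∀ n, eval ![x, 1, z n] F = 0) : False := by
  have hline (w : K) : eval ![x, 1, w] F = 0 := by
    let p : Polynomial K := aeval ![Polynomial.C x, 1, Polynomial.X] F
    have hp (w : K) : p.eval w = eval ![x, 1, w] F := by
      have : ((Polynomial.evalRingHom w).comp (aeval (R := K)
          ![(Polynomial.C x : Polynomial K), 1, Polynomial.X] :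
            MvPolynomial (Fin 3) K →+* _)) = eval ![x, 1, w] := by
        refine MvPolynomial.ringHom_ext (fun r => ?_) fun i => ?_
        · simp
        · fin_cases i <;> simp
      exact RingHom.congr_fun this F
    have hp0 : p = 0 := Polynomial.eq_zero_of_infinite_isRoot p <|
      (Set.infinite_range_of_injective hz).mono (by
        rintro _ ⟨n, rfl⟩
        change p.eval (z n) = 0
        rw [hp, h])
    rw [← hp, hp0, Polynomial.eval_zero]
  let g : Fin 3 → MvPolynomial (Fin 3) K := ![C x * X 1, X 1, X 2]
  have hev (G : MvPolynomial (Fin 3) K) (P : Fin 3 → K) :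
      eval P (aeval g G) = eval ![x * P 1, P 1, P 2] G := by
    have : ((eval P).comp (aeval (R := K) g : MvPolynomial (Fin 3) K →+* _)) =
        eval ![x * P 1, P 1, P 2] := by
      refine MvPolynomial.ringHom_ext (fun r => ?_) fun i => ?_
      · simp [algebraMap_eq]
      · fin_cases i <;> simp [g]
    exact RingHom.congr_fun this G
  have hgF : aeval g F = 0 := by
    have : X 1 * aeval g F = 0 := by
      refine MvPolynomial.funext fun P => ?_
      rw [map_mul, eval_X, hev, map_zero]
      by_cases h1 : P 1 = 0
      · rw [h1, zero_mul]
      · have h2 := hF.aeval_mul_const ![x, 1, P 2 / P 1] (P 1)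
        have h3 : (fun i => ![x, 1, P 2 / P 1] i * P 1) = ![x * P 1, P 1, P 2] := by
          ext i
          fin_cases i <;> simp [h1]
        rw [h3] at h2
        have h4 : eval ![x * P 1, P 1, P 2] F = eval ![x, 1, P 2 / P 1] F * P 1 ^ d := h2
        rw [h4, hline, zero_mul, mul_zero]
    exact (mul_eq_zero.1 this).resolve_left (X_ne_zero 1)
  have h2 : aeval g (pderiv 2 F) = 0 := by
    have := pderiv_aeval_eq_sum g F 2
    rw [hgF, Fin.sum_univ_three] at this
    simpa [g, pderiv_X] using this.symm
  have h1 : C x * aeval g (pderiv 0 F) + aeval g (pderiv 1 F) = 0 := by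
    have := pderiv_aeval_eq_sum g F 1
    rw [hgF, Fin.sum_univ_three] at this
    simpa [g, pderiv_X, mul_comm] using this.symm
  set q := aeval g (pderiv 0 F) with hq
  have hdvd (i : Fin 3) : q ∣ aeval g (X i ^ N : MvPolynomial (Fin 3) K) := by
    rw [← Ideal.mem_span_singleton]
    suffices h3 : Ideal.span (Set.range fun j => pderiv j F) ≤
        (Ideal.span {q}).comap (aeval (R := K) g) from h3 (hN i)
    refine Ideal.span_le.2 ?_
    rintro _ ⟨j, rfl⟩
    change aeval g (pderiv j F) ∈ Ideal.span {q}
    rw [Ideal.mem_span_singleton]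
    fin_cases j
    · exact dvd_rfl
    · change q ∣ aeval g (pderiv 1 F)
      rw [eq_neg_of_add_eq_zero_right h1]
      exact (Dvd.intro_left _ rfl).neg_right
    · change q ∣ aeval g (pderiv 2 F)
      rw [h2]
      exact dvd_zero _
  have hd1 : q ∣ X 1 ^ N := by simpa [g] using hdvd 1
  have hd2 : q ∣ X 2 ^ N := by simpa [g] using hdvd 2
  obtain ⟨i, -, hi⟩ := (dvd_prime_pow (X_prime (i := (1 : Fin 3)) (R := K)) N).1 hd1
  obtain rfl | hi0 := Nat.eq_zero_or_pos i
  · rw [pow_zero, associated_one_iff_isUnit] at hi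
    have h3 := (hi.map (eval (0 : Fin 3 → K))).ne_zero
    apply h3
    have h4 := (hF.pderiv (i := 0)).aeval_mul_const (0 : Fin 3 → K) 0
    have h5 : (fun i => (0 : Fin 3 → K) i * 0) = ![x * (0 : Fin 3 → K) 1, (0 : Fin 3 → K) 1,
      (0 : Fin 3 → K) 2] := by
      ext i
      fin_cases i <;> simp
    rw [h5, zero_pow (by omega), mul_zero] at h4
    rw [hq, hev]
    exact h4
  · have h3 : (X 1 : MvPolynomial (Fin 3) K) ∣ X 2 ^ N :=
      ((dvd_pow_self _ hi0.ne').trans hi.symm.dvd).trans hd2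
    have h4 := map_dvd (eval ![(0 : K), 0, 1]) h3
    rw [eval_X, map_pow, eval_X] at h4
    change (0 : K) ∣ 1 ^ N at h4
    rw [zero_dvd_iff, one_pow] at h4
    exact one_ne_zero h4

/-- **Quadratic geometric progressions on smooth plane curves of degree `≥ 5` are finite.**
Let `C : F(X,Y,Z) = 0` be a smooth projective plane curve of degree `d ≥ 5` over a number
field `k`.  Then there is no infinite quadratic geometric progression sequence on `C`:
there is no infinite sequence of pairwise distinct points `P i = (x i : 1 : z i)` on `C`,
each defined over an extension of `k` of degree at most `2` (i.e. lying in `Γ₂(C,k)`), whose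
`x`-coordinates form a geometric progression `x i = t' * t ^ (i+1)` with `t, t' ∈ k*`. -/
theorem quadratic_geometric_progression_deg_ge_five_is_finite
    (k : Type) [Field k] [NumberField k]
    (d : ℕ) (hd : 5 ≤ d)
    (F : MvPolynomial (Fin 3) k) (hF : IsSmoothPlaneCurve d F)
    (t t' : k) (ht : t ≠ 0) (ht' : t' ≠ 0)
    (P : ℕ → Fin 3 → AlgebraicClosure k) (hinj : Function.Injective P)
    (honC : ∀ i, eval (P i) (map (algebraMap k (AlgebraicClosure k)) F) = 0)
    (hx : ∀ i, P i 0 = algebraMap k (AlgebraicClosure k) (t' * t ^ (i + 1)))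
    (hy : ∀ i, P i 1 = 1)
    (hquad : ∀ i,
      Module.finrank k (IntermediateField.adjoin k (Set.range (P i))) ≤ 2) :
    False := by
  classical
  let K := AlgebraicClosure k
  set φ := algebraMap k K with hφ
  have : CharZero K := charZero_of_injective_algebraMap φ.injective
  have : IsScalarTower ℚ k K := inferInstance
  have : Algebra.IsAlgebraic ℚ K := Algebra.IsAlgebraic.trans ℚ k K
  have hsmooth : ∀ Q : Fin 3 → K, Q ≠ 0 → ∃ i, eval Q (pderiv i (map φ F)) ≠ 0 := by
    intro Q hQ
    obtain ⟨i, hi⟩ := hF.2 Q hQ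
    exact ⟨i, by rwa [pderiv_map]⟩
  obtain ⟨N, hN⟩ := exists_X_pow_mem_span_pderiv (map φ F) hsmooth
  have hPn (n : ℕ) : P n = ![φ (t' * t ^ (n + 1)), 1, P n 2] := by
    ext i
    fin_cases i
    · exact hx n
    · exact hy n
    · rfl
  by_cases hroot : ∀ n > 0, t ^ n ≠ 1
  · obtain ⟨i, hi⟩ := hsmooth ![0, 0, 1] fun h => one_ne_zero (congrFun h 2)
    obtain ⟨m, hm, hmF⟩ := exists_coeff_ne_zero_of_eval_pderiv_ne_zero (hF.1.map φ) i hi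
    rw [coeff_map] at hmF
    obtain ⟨v, hv, hvt⟩ := exists_hasLiouvilleBound_lt_one k K t ht hroot
    refine false_of_quadratic_points d hd F hF.1 N hN m hm (fun h => hmF (by rw [h, map_zero]))
      v hv t ht hvt (t' * t) (mul_ne_zero ht' ht) (fun n => P n 2) (fun n => ?_) fun n => ?_
    · have := honC n
      rw [hPn n, eval_map, ← aeval_def] at this
      rw [← this, mul_assoc, ← pow_succ']
    · refine le_trans ?_ (hquad n)
      have : FiniteDimensional k (IntermediateField.adjoin k (Set.range (P n))) :=
        IntermediateField.finiteDimensional_adjoin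
          fun x _ => Algebra.IsIntegral.isIntegral x
      refine Submodule.finrank_mono
        (s := (IntermediateField.adjoin k {P n 2}).toSubalgebra.toSubmodule)
        (t := (IntermediateField.adjoin k (Set.range (P n))).toSubalgebra.toSubmodule) ?_
      exact IntermediateField.adjoin.mono k _ _ (Set.singleton_subset_iff.2 ⟨2, rfl⟩)
  · push Not at hroot
    obtain ⟨n, hn, htn⟩ := hroot
    have hQ (i : ℕ) : P (n * i) = ![φ (t' * t), 1, P (n * i) 2] := by
      conv_lhs => rw [hPn]
      rw [pow_succ, pow_mul, htn, one_pow, one_mul]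
    refine false_of_infinite_vertical_line (d := d) (by omega) (map φ F) (hF.1.map φ) N hN
      (φ (t' * t)) (fun i => P (n * i) 2) (fun i j hij => ?_) fun i => ?_
    · have : P (n * i) = P (n * j) := by
        rw [hQ i, hQ j]
        simp only at hij
        rw [hij]
      exact Nat.eq_of_mul_eq_mul_left hn (hinj this)
    · rw [← hQ]
      exact honC _
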